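/- Let K, L be convex bodies in R^n each containing a ball of radius r and contained in a concentric ball of radius R (0 < r < R), and let 0 < ε < 1. If the surface tensors of K and L coincide for all ranks 0 ≤ s ≤ s_0, then the translative Hausdorff distance satisfies δ^t(K, L) ≤ c(n, r, R, ε) s_0^{−(1−ε)/(4n)} for a constant c > 0 depending only on n, r, R, ε. -/

import Mathlib

open MeasureTheory Metric Real Filter
open scoped InnerProductSpace ENNReal NNReal Topology

noncomputable section

abbrev En (n : ℕ) := EuclideanSpace ℝ (Fin n)

abbrev Sph (n : ℕ) : Set (En n) := Metric.sphere 0 1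

/-- `μ` is the surface area measure `S_{n-1}(K, ·)` of the convex body `K`. -/
def IsSurfaceAreaMeasure {n : ℕ} (K : Set (En n)) (μ : Measure (Sph n)) : Prop :=
  ((interior K).Nonempty ∧ ∀ ω : Set (Sph n), MeasurableSet ω →
      μ ω = μH[((n : ℝ) - 1)]
        {x ∈ frontier K | ∃ u ∈ ω, ∀ y ∈ K, ⟪y - x, (u : En n)⟫_ℝ ≤ 0})
  ∨ (interior K = ∅ ∧ ∃ u u' : Sph n, (u' : En n) = -(u : En n) ∧
      (∃ c : ℝ, ∀ x ∈ K, ⟪x, (u : En n)⟫_ℝ = c) ∧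
      μ = (μH[((n : ℝ) - 1)] K) • (Measure.dirac u + Measure.dirac u'))

/-- The moment of a Borel measure on the sphere corresponding to the
multi-index `i : Fin n → ℕ`. -/
def sphMoment {n : ℕ} (μ : Measure (Sph n)) (i : Fin n → ℕ) : ℝ :=
  ∫ u, ∏ j, ((u : En n) j) ^ (i j) ∂μ

/-- The translative Hausdorff distance `δᵗ(K, L) = inf_x δ(K, L + x)`. -/
def transHausdorffDist {n : ℕ} (K L : Set (En n)) : ℝ :=
  ⨅ x : En n, Metric.hausdorffDist K ((fun y => y + x) '' L)

/-- Orthonormal coordinates of Euclidean space in which a given unit vector is the last axis. -/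
theorem exists_frame {m : ℕ} (u : En (m + 1)) (hu : ‖u‖ = 1) :
    ∃ Θ : En (m + 1) ≃L[ℝ] En m × ℝ, MeasurePreserving Θ volume volume ∧
      (∀ z, (Θ z).2 = ⟪z, u⟫_ℝ) ∧ ∀ z, ‖z‖ ^ 2 = ‖(Θ z).1‖ ^ 2 + (Θ z).2 ^ 2 := by
  have hfin : Module.finrank ℝ (En (m + 1)) = Module.finrank ℝ (WithLp 2 (En m × ℝ)) := by
    rw [(WithLp.linearEquiv 2 ℝ (En m × ℝ)).finrank_eq]
    simp
  let e : En (m + 1) ≃ₗᵢ[ℝ] WithLp 2 (En m × ℝ) := (stdOrthonormalBasis ℝ _).equiv (stdOrthonormalBasis ℝ _) (finCongr hfin)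
  let w : WithLp 2 (En m × ℝ) := WithLp.toLp 2 (0, 1)
  have hw : ‖e u‖ = ‖w‖ := by
    rw [e.norm_map, hu, WithLp.prod_norm_eq_of_L2]
    simp [w]
  let ρ := (ℝ ∙ (e u - w))ᗮ.reflection
  let T : En (m + 1) ≃ₗᵢ[ℝ] WithLp 2 (En m × ℝ) := e.trans ρ
  have hT : T u = w := by
    change ρ (e u) = w
    exact Submodule.reflection_sub hw
  let L : En (m + 1) ≃L[ℝ] En m × ℝ :=
    T.toContinuousLinearEquiv.trans (WithLp.prodContinuousLinearEquiv 2 ℝ (En m) ℝ)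
  refine ⟨L, ?_, fun z => ?_, fun z => ?_⟩
  · exact (WithLp.volume_preserving_ofLp (En m) ℝ).comp T.measurePreserving
  · rw [← T.inner_map_map, hT, WithLp.prod_inner_apply]
    simp [w, L]
  · rw [← T.norm_map, WithLp.prod_norm_sq_eq_of_L2]
    simp [L]

open Set in
/-- The quantile function of a positive continuous density on an open interval. -/
theorem exists_quantile {a b : ℝ} (hab : a < b) {f : ℝ → ℝ} (hf : ContinuousOn f (Ioo a b))
    (hpos : ∀ s ∈ Ioo a b, 0 < f s) (hint : IntegrableOn f (Ioo a b)) :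
    ∃ x : ℝ → ℝ, x '' Ioo 0 1 = Ioo a b ∧ StrictMonoOn x (Ioo 0 1) ∧
      ∀ τ ∈ Ioo (0 : ℝ) 1, HasDerivAt x ((∫ s in Ioo a b, f s) / f (x τ)) τ := by
  set V : ℝ := ∫ s in Ioo a b, f s with hV
  have hint' : IntervalIntegrable f volume a b := by
    rw [intervalIntegrable_iff_integrableOn_Ioo_of_le hab.le]
    exact hint
  have hVeq : V = ∫ s in a..b, f s := by
    rw [intervalIntegral.integral_of_le hab.le, hV, integral_Ioc_eq_integral_Ioo]
  have hVpos : 0 < V := by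
    rw [hVeq]
    exact intervalIntegral.intervalIntegral_pos_of_pos_on hint' hpos hab
  let F : ℝ → ℝ := fun s => (∫ t in a..s, f t) / V
  have hFd : ∀ s ∈ Ioo a b, HasDerivAt F (f s / V) s := by
    intro s hs
    have hs' : IntervalIntegrable f volume a s :=
      hint'.mono_set (by rw [uIcc_of_le hs.1.le, uIcc_of_le hab.le]; exact Icc_subset_Icc_right hs.2.le)
    refine (intervalIntegral.integral_hasDerivAt_right hs' ?_ ?_).div_const V
    · exact hf.stronglyMeasurableAtFilter isOpen_Ioo s hs
    · exact hf.continuousAt (isOpen_Ioo.mem_nhds hs)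
  have hFc : ContinuousOn F (Icc a b) := by
    have := intervalIntegral.continuousOn_primitive_interval' (a := a) hint' (by simp)
    rw [uIcc_of_le hab.le] at this
    exact this.div_const V
  have hFa : F a = 0 := by simp [F]
  have hFb : F b = 1 := by
    simp only [F, ← hVeq]
    exact div_self hVpos.ne'
  have hFm : StrictMonoOn F (Icc a b) := by
    refine strictMonoOn_of_deriv_pos (convex_Icc a b) hFc fun s hs => ?_
    rw [interior_Icc] at hs
    rw [(hFd s hs).deriv]
    exact div_pos (hpos s hs) hVpos
  have hFmaps : MapsTo F (Ioo a b) (Ioo 0 1) := by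
    intro s hs
    refine ⟨?_, ?_⟩
    · rw [← hFa]
      exact hFm (left_mem_Icc.2 hab.le) (Ioo_subset_Icc_self hs) hs.1
    · rw [← hFb]
      exact hFm (Ioo_subset_Icc_self hs) (right_mem_Icc.2 hab.le) hs.2
  have hFm' : StrictMonoOn F (Ioo a b) := hFm.mono Ioo_subset_Icc_self
  have hsurj : SurjOn F (Ioo a b) (Ioo 0 1) := by
    have := intermediate_value_Ioo hab.le hFc
    rwa [hFa, hFb] at this
  let x := Function.invFunOn F (Ioo a b)
  have hxmem : ∀ τ ∈ Ioo (0 : ℝ) 1, x τ ∈ Ioo a b := fun τ hτ =>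
    Function.invFunOn_mem (hsurj hτ)
  have hxF : ∀ τ ∈ Ioo (0 : ℝ) 1, F (x τ) = τ := fun τ hτ =>
    Function.invFunOn_eq (hsurj hτ)
  have hFx : ∀ s ∈ Ioo a b, x (F s) = s := fun s hs =>
    hFm'.injOn (hxmem _ (hFmaps hs)) hs (hxF _ (hFmaps hs))
  have himg : x '' Ioo 0 1 = Ioo a b := by
    refine Subset.antisymm (image_subset_iff.2 hxmem) fun s hs => ⟨F s, hFmaps hs, hFx s hs⟩
  have hxm : StrictMonoOn x (Ioo 0 1) := by
    intro τ hτ σ hσ h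
    rw [← hxF τ hτ, ← hxF σ hσ] at h
    exact (hFm'.lt_iff_lt (hxmem τ hτ) (hxmem σ hσ)).1 h
  refine ⟨x, himg, hxm, fun τ hτ => ?_⟩
  have hxc : ContinuousAt x τ := by
    refine hxm.continuousAt_of_image_mem_nhds (isOpen_Ioo.mem_nhds hτ) ?_
    rw [himg]
    exact isOpen_Ioo.mem_nhds (hxmem τ hτ)
  have := HasDerivAt.of_local_left_inverse hxc (hFd _ (hxmem τ hτ))
    (div_pos (hpos _ (hxmem τ hτ)) hVpos).ne'
    (by filter_upwards [isOpen_Ioo.mem_nhds hτ] with σ hσ using hxF σ hσ)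
  rwa [inv_div] at this

/-- Horizontal slice of a set in a product with the real line. -/
def hslice {m : ℕ} (K : Set (En m × ℝ)) (s : ℝ) : Set (En m) := {w | (w, s) ∈ K}

theorem isCompact_hslice {m : ℕ} {K : Set (En m × ℝ)} (hK : IsCompact K) (s : ℝ) :
    IsCompact (hslice K s) := by
  have : hslice K s = Prod.fst '' (K ∩ Prod.snd ⁻¹' {s}) := by
    ext w
    constructor
    · intro h
      exact ⟨(w, s), ⟨h, rfl⟩, rfl⟩
    · rintro ⟨⟨w', s'⟩, ⟨h, h'⟩, rfl⟩
      obtain rfl : s' = s := h'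
      exact h
  rw [this]
  exact (hK.inter_right (isClosed_singleton.preimage continuous_snd)).image continuous_fst

theorem convex_hslice {m : ℕ} {K : Set (En m × ℝ)} (hK : Convex ℝ K) (s : ℝ) :
    Convex ℝ (hslice K s) := by
  intro w hw w' hw' α β hα hβ hαβ
  have := hK hw hw' hα hβ hαβ
  simpa [hslice, ← add_mul, hαβ] using this

theorem hslice_volume_ne_top {m : ℕ} {K : Set (En m × ℝ)} (hK : IsCompact K) (s : ℝ) :
    volume (hslice K s) ≠ ∞ := (isCompact_hslice hK s).measure_lt_top.ne

theorem volume_eq_lintegral_hslice {m : ℕ} {K : Set (En m × ℝ)} (hK : IsCompact K) :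
    volume K = ∫⁻ s, volume (hslice K s) := by
  rw [Measure.volume_eq_prod, Measure.prod_apply_symm hK.measurableSet]
  rfl

/-- Slices of a convex set shrink at most homothetically towards any of its points. -/
theorem hslice_homothety {m : ℕ} {K : Set (En m × ℝ)} (hK : Convex ℝ K) (hKc : IsCompact K)
    {w₁ : En m} {s₀ s₁ θ : ℝ} (h₁ : (w₁, s₁) ∈ K) (hθ : 0 ≤ θ) (hθ1 : θ ≤ 1) :
    (1 - θ) ^ m * volume.real (hslice K s₀) ≤
      volume.real (hslice K ((1 - θ) * s₀ + θ * s₁)) := by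
  have hsub : AffineMap.homothety w₁ (1 - θ) '' hslice K s₀ ⊆
      hslice K ((1 - θ) * s₀ + θ * s₁) := by
    rintro _ ⟨w, hw, rfl⟩
    have := hK hw h₁ (sub_nonneg.2 hθ1) hθ (by ring)
    simp only [hslice, Set.mem_ofPred_eq, Prod.smul_mk, Prod.mk_add_mk, smul_eq_mul] at this ⊢
    convert this using 2
    rw [AffineMap.homothety_apply, vsub_eq_sub, vadd_eq_add]
    module
  have h := measure_mono (μ := volume) hsub
  rw [Measure.addHaar_image_homothety, finrank_euclideanSpace, Fintype.card_fin,
    abs_of_nonneg (pow_nonneg (sub_nonneg.2 hθ1) m)] at h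
  have h' := ENNReal.toReal_mono (hslice_volume_ne_top hKc _) h
  rwa [ENNReal.toReal_mul, ENNReal.toReal_ofReal (pow_nonneg (sub_nonneg.2 hθ1) m)] at h'

/-- The slices of a compact convex set vary continuously over the interior of the height range. -/
theorem hslice_near {m : ℕ} {K : Set (En m × ℝ)} (hK : Convex ℝ K) (hKc : IsCompact K)
    {a b d s s' : ℝ} (ha : a ∈ Prod.snd '' K) (hb : b ∈ Prod.snd '' K) (hd : 0 < d)
    (hs : s ∈ Set.Icc (a + d) (b - d)) (hss : |s' - s| ≤ d) :
    (1 - |s' - s| / d) ^ m * volume.real (hslice K s) ≤ volume.real (hslice K s') := by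
  obtain ⟨⟨wa, a⟩, hwa, rfl⟩ := ha
  obtain ⟨⟨wb, b⟩, hwb, rfl⟩ := hb
  simp only at hs
  have key : ∀ e w, (w, e) ∈ K → 0 < |e - s| → d ≤ |e - s| → (s' - s) / (e - s) = |s' - s| / |e - s| →
      (1 - |s' - s| / d) ^ m * volume.real (hslice K s) ≤ volume.real (hslice K s') := by
    intro e w hw h0 hde hdiv
    have hle : |s' - s| / |e - s| ≤ |s' - s| / d := by gcongr
    have h1 : |s' - s| / d ≤ 1 := (div_le_one hd).2 hss
    have h := hslice_homothety hK hKc (s₀ := s) hw (θ := |s' - s| / |e - s|) (by positivity)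
      (hle.trans h1)
    have he : e - s ≠ 0 := abs_pos.1 h0
    have heq : (1 - |s' - s| / |e - s|) * s + |s' - s| / |e - s| * e = s' := by
      rw [← hdiv]
      field_simp
      ring
    rw [heq] at h
    refine le_trans ?_ h
    gcongr
  rcases le_total s s' with h | h
  · refine key b wb hwb ?_ ?_ ?_
    · exact abs_pos.2 (by linarith [hs.2])
    · rw [abs_of_nonneg] <;> linarith [hs.2]
    · rw [abs_of_nonneg (sub_nonneg.2 h), abs_of_nonneg]
      linarith [hs.2]
  · refine key a wa hwa ?_ ?_ ?_
    · exact abs_pos.2 (by linarith [hs.1])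
    · rw [abs_of_nonpos] <;> linarith [hs.1]
    · rw [abs_of_nonpos (sub_nonpos.2 h), abs_of_nonpos (by linarith [hs.1]), neg_div_neg_eq]

theorem continuousOn_hslice {m : ℕ} {K : Set (En m × ℝ)} (hK : Convex ℝ K) (hKc : IsCompact K)
    {a b : ℝ} (ha : a ∈ Prod.snd '' K) (hb : b ∈ Prod.snd '' K) :
    ContinuousOn (fun s => volume.real (hslice K s)) (Set.Ioo a b) := by
  intro s hs
  apply ContinuousAt.continuousWithinAt
  set d := min (s - a) (b - s) / 2 with hd
  have hd0 : 0 < d := by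
    have : 0 < min (s - a) (b - s) := lt_min (by linarith [hs.1]) (by linarith [hs.2])
    linarith
  have h1 : 2 * d ≤ s - a := by rw [hd]; linarith [min_le_left (s - a) (b - s)]
  have h2 : 2 * d ≤ b - s := by rw [hd]; linarith [min_le_right (s - a) (b - s)]
  have hlim : Tendsto (fun s' => 1 - |s' - s| / d) (𝓝 s) (𝓝 1) := by
    have : Continuous fun s' => 1 - |s' - s| / d := by fun_prop
    have h := this.tendsto s
    simpa using h
  have hlow : Tendsto (fun s' => (1 - |s' - s| / d) ^ m * volume.real (hslice K s)) (𝓝 s)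
      (𝓝 (volume.real (hslice K s))) := by
    simpa using (hlim.pow m).mul_const (volume.real (hslice K s))
  have hup : Tendsto (fun s' => volume.real (hslice K s) / (1 - |s' - s| / d) ^ m) (𝓝 s)
      (𝓝 (volume.real (hslice K s))) := by
    have h := (tendsto_const_nhds (x := volume.real (hslice K s)) (f := 𝓝 s)).div (hlim.pow m)
      (by simp)
    rw [one_pow, div_one] at h
    exact h
  have hev : ∀ᶠ s' in 𝓝 s, |s' - s| < d := by
    filter_upwards [Metric.ball_mem_nhds s hd0] with s' hs'
    rwa [Metric.mem_ball, Real.dist_eq] at hs'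
  refine tendsto_of_tendsto_of_tendsto_of_le_of_le' hlow hup ?_ ?_
  · filter_upwards [hev] with s' hs'
    exact hslice_near hK hKc ha hb hd0 ⟨by linarith, by linarith⟩ hs'.le
  · filter_upwards [hev] with s' hs'
    have h3 := abs_lt.1 hs'
    have h4 : 0 < 1 - |s' - s| / d := by
      rw [sub_pos, div_lt_one hd0]
      exact hs'
    rw [le_div_iff₀ (by positivity), mul_comm]
    have h5 := hslice_near (s := s') (s' := s) hK hKc ha hb hd0
      ⟨by linarith, by linarith⟩ (by rw [abs_sub_comm]; exact hs'.le)
    rwa [abs_sub_comm] at h5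

theorem integral_indicator_hslice {m : ℕ} {K : Set (En m × ℝ)} (hKc : IsCompact K) (g : ℝ → ℝ)
    (s : ℝ) : ∫ w : En m, K.indicator (fun z => g z.2) (w, s) = g s * volume.real (hslice K s) := by
  have h1 : (fun w : En m => K.indicator (fun z => g z.2) (w, s)) =
      (hslice K s).indicator fun _ => g s := by
    ext w
    by_cases h : (w, s) ∈ K
    · rw [Set.indicator_of_mem h, Set.indicator_of_mem (show w ∈ hslice K s from h)]
    · rw [Set.indicator_of_notMem h, Set.indicator_of_notMem (show w ∉ hslice K s from h)]
  rw [h1, integral_indicator_const _ (isCompact_hslice hKc s).measurableSet, smul_eq_mul, mul_comm]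

theorem hslice_empty {m : ℕ} {K : Set (En m × ℝ)} {a b s : ℝ} (h : Prod.snd '' K = Set.Icc a b)
    (hs : s ∉ Set.Icc a b) : hslice K s = ∅ := by
  ext w
  simp only [Set.mem_empty_iff_false, iff_false]
  intro hw
  exact hs (h ▸ ⟨(w, s), hw, rfl⟩)

theorem integrable_indicator_snd {m : ℕ} {K : Set (En m × ℝ)} (hKc : IsCompact K) {g : ℝ → ℝ}
    (hg : Continuous g) :
    Integrable (K.indicator fun z => g z.2) ((volume : Measure (En m)).prod volume) := by
  rw [integrable_indicator_iff hKc.measurableSet]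
  exact ContinuousOn.integrableOn_compact hKc (by fun_prop)

theorem integrableOn_hslice {m : ℕ} {K : Set (En m × ℝ)} (hKc : IsCompact K) (s : Set ℝ) :
    IntegrableOn (fun s => volume.real (hslice K s)) s := by
  have h := (integrable_indicator_snd hKc (continuous_const (y := (1 : ℝ)))).integral_prod_right
  simp only [integral_indicator_hslice hKc (fun _ => 1), one_mul] at h
  exact h.integrableOn

theorem setIntegral_snd {m : ℕ} {K : Set (En m × ℝ)} (hKc : IsCompact K) {a b : ℝ}
    (h : Prod.snd '' K = Set.Icc a b) {g : ℝ → ℝ} (hg : Continuous g) :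
    ∫ z in K, g z.2 = ∫ s in Set.Ioo a b, g s * volume.real (hslice K s) := by
  rw [← integral_indicator hKc.measurableSet, Measure.volume_eq_prod,
    integral_prod_symm _ (integrable_indicator_snd hKc hg)]
  simp only [integral_indicator_hslice hKc]
  rw [← integral_Icc_eq_integral_Ioo]
  refine (setIntegral_eq_integral_of_forall_compl_eq_zero fun s hs => ?_).symm
  rw [hslice_empty h hs]
  simp

theorem hslice_pos {m : ℕ} {K : Set (En m × ℝ)} (hK : Convex ℝ K) (hKc : IsCompact K)
    (hint : (interior K).Nonempty) {a b s : ℝ} (h : Prod.snd '' K = Set.Icc a b)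
    (hs : s ∈ Set.Ioo a b) : 0 < volume.real (hslice K s) := by
  obtain ⟨⟨w₀, s₀⟩, h₀⟩ := hint
  have hpos₀ : 0 < volume.real (hslice K s₀) := by
    refine ENNReal.toReal_pos ?_ (hslice_volume_ne_top hKc _)
    have ho : IsOpen ((fun w : En m => (w, s₀)) ⁻¹' interior K) :=
      isOpen_interior.preimage (by fun_prop)
    have := ho.measure_pos volume ⟨w₀, h₀⟩
    refine (this.trans_le (measure_mono fun w hw => ?_)).ne'
    exact interior_subset (s := K) hw
  have hs₀ : s₀ ∈ Set.Icc a b := h ▸ ⟨(w₀, s₀), interior_subset h₀, rfl⟩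
  have hab : a ≤ b := hs₀.1.trans hs₀.2
  have key : ∀ e ∈ Set.Icc a b, ∀ θ : ℝ, 0 ≤ θ → θ < 1 → (1 - θ) * s₀ + θ * e = s →
      0 < volume.real (hslice K s) := by
    intro e he θ hθ hθ1 heq
    rw [← h] at he
    obtain ⟨⟨w, e⟩, hw, rfl⟩ := he
    have := hslice_homothety (s₀ := s₀) hK hKc hw hθ hθ1.le
    rw [heq] at this
    exact lt_of_lt_of_le (mul_pos (pow_pos (sub_pos.2 hθ1) m) hpos₀) this
  rcases le_total s₀ s with hle | hle
  · have hd : 0 < b - s₀ := by linarith [hs.2]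
    refine key b (Set.right_mem_Icc.2 hab) ((s - s₀) / (b - s₀))
      (div_nonneg (by linarith) hd.le) ((div_lt_one hd).2 (by linarith [hs.2])) ?_
    field_simp
    ring
  · have hd : 0 < s₀ - a := by linarith [hs.1]
    refine key a (Set.left_mem_Icc.2 hab) ((s₀ - s) / (s₀ - a))
      (div_nonneg (by linarith) hd.le) ((div_lt_one hd).2 (by linarith [hs.1])) ?_
    field_simp
    ring

theorem rpow_one_div_pow_volume {m : ℕ} {A : Set (En m)} (hA : 0 < volume.real A) :
    (volume.real A ^ (1 / (m : ℝ))) ^ m = volume.real A := by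
  rcases Nat.eq_zero_or_pos m with rfl | hm
  · have h1 : A = Set.univ := by
      rcases A.eq_empty_or_nonempty with rfl | h
      · simp at hA
      · exact Subsingleton.eq_univ_of_nonempty h
    rw [h1, volume_euclideanSpace_eq_dirac]
    simp
  · rw [← Real.rpow_natCast, ← Real.rpow_mul hA.le, one_div_mul_cancel (by positivity),
      Real.rpow_one]

/-- A convex body cut into horizontal slices, parametrized by the volume fraction below the slice:
`x τ` is the height and `P τ` the volume radius of the slice. -/
structure Slicing {m : ℕ} (K : Set (En m × ℝ)) where
  (a b : ℝ)
  (x P : ℝ → ℝ)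
  snd_image : Prod.snd '' K = Set.Icc a b
  hab : a < b
  image_x : x '' Set.Ioo 0 1 = Set.Ioo a b
  mono : StrictMonoOn x (Set.Ioo 0 1)
  P_pos : ∀ τ ∈ Set.Ioo (0 : ℝ) 1, 0 < P τ
  P_pow : ∀ τ ∈ Set.Ioo (0 : ℝ) 1, P τ ^ m = volume.real (hslice K (x τ))
  P_cont : ContinuousOn P (Set.Ioo 0 1)
  hasDerivAt : ∀ τ ∈ Set.Ioo (0 : ℝ) 1, HasDerivAt x (volume.real K / P τ ^ m) τ
  mean : ∫ τ in Set.Ioo 0 1, x τ = (∫ z in K, z.2) / volume.real K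

theorem nonempty_slicing {m : ℕ} {K : Set (En m × ℝ)} (hK : Convex ℝ K) (hKc : IsCompact K)
    (hint : (interior K).Nonempty) : Nonempty (Slicing K) := by
  have hne : (Prod.snd '' K).Nonempty := (hint.mono interior_subset).image _
  have hic : IsCompact (Prod.snd '' K) := hKc.image continuous_snd
  have himg : Prod.snd '' K = Set.Icc (sInf (Prod.snd '' K)) (sSup (Prod.snd '' K)) :=
    eq_Icc_of_connected_compact
      ⟨hne, (hK.linear_image (LinearMap.snd ℝ (En m) ℝ)).isPreconnected⟩ hic
  set a := sInf (Prod.snd '' K)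
  set b := sSup (Prod.snd '' K)
  have hab : a < b := by
    by_contra hcon
    have hsub : Prod.snd '' interior K ⊆ {a} := by
      rintro _ ⟨z, hz, rfl⟩
      have : z.2 ∈ Set.Icc a b := himg ▸ ⟨z, interior_subset hz, rfl⟩
      exact le_antisymm (this.2.trans (not_lt.1 hcon)) this.1
    have ho : IsOpen (Prod.snd '' interior K) := isOpenMap_snd _ isOpen_interior
    have h1 := ho.measure_pos volume (hint.image _)
    have h2 := measure_mono (μ := volume) hsub
    simp at h2
    rw [h2] at h1
    exact lt_irrefl _ h1
  have ha : a ∈ Prod.snd '' K := himg ▸ Set.left_mem_Icc.2 hab.le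
  have hb : b ∈ Prod.snd '' K := himg ▸ Set.right_mem_Icc.2 hab.le
  have hpos := fun s hs => hslice_pos (s := s) hK hKc hint himg hs
  have hcont := continuousOn_hslice hK hKc ha hb
  obtain ⟨x, hx1, hx2, hx3⟩ := exists_quantile hab hcont hpos (integrableOn_hslice hKc _)
  have hV : ∫ s in Set.Ioo a b, volume.real (hslice K s) = volume.real K := by
    have := setIntegral_snd hKc himg (continuous_const (y := (1 : ℝ)))
    simp only [one_mul] at this
    rw [← this]
    simp [Measure.real]
  have hVpos : 0 < volume.real K :=
    ENNReal.toReal_pos (((isOpen_interior.measure_pos volume hint).trans_le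
      (measure_mono interior_subset)).ne') hKc.measure_lt_top.ne
  have hxmem : ∀ τ ∈ Set.Ioo (0 : ℝ) 1, x τ ∈ Set.Ioo a b := fun τ hτ =>
    hx1 ▸ Set.mem_image_of_mem x hτ
  have hPp : ∀ τ ∈ Set.Ioo (0 : ℝ) 1,
      (volume.real (hslice K (x τ)) ^ (1 / (m : ℝ))) ^ m = volume.real (hslice K (x τ)) :=
    fun τ hτ => rpow_one_div_pow_volume (hpos _ (hxmem τ hτ))
  have hder : ∀ τ ∈ Set.Ioo (0 : ℝ) 1,
      HasDerivAt x (volume.real K / volume.real (hslice K (x τ))) τ := by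
    intro τ hτ
    have := hx3 τ hτ
    rwa [hV] at this
  refine ⟨⟨a, b, x, fun τ => volume.real (hslice K (x τ)) ^ (1 / (m : ℝ)), himg, hab, hx1, hx2,
    fun τ hτ => Real.rpow_pos_of_pos (hpos _ (hxmem τ hτ)) _, hPp, ?_, ?_, ?_⟩⟩
  · refine ContinuousOn.rpow_const ?_ fun τ hτ => Or.inl (hpos _ (hxmem τ hτ)).ne'
    exact hcont.comp (fun τ hτ => (hder τ hτ).continuousAt.continuousWithinAt) hxmem
  · intro τ hτ
    simp only [hPp τ hτ]
    exact hder τ hτ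
  · rw [setIntegral_snd (g := fun s => s) hKc himg continuous_id, ← hx1,
      integral_image_eq_integral_abs_deriv_smul measurableSet_Ioo
        (fun τ hτ => (hder τ hτ).hasDerivWithinAt) hx2.injOn, eq_div_iff hVpos.ne', mul_comm,
      ← integral_const_mul]
    refine setIntegral_congr_fun measurableSet_Ioo fun τ hτ => ?_
    have := hpos _ (hxmem τ hτ)
    simp only [smul_eq_mul]
    rw [abs_of_pos (div_pos hVpos this)]
    field_simp

section BrunnMinkowskiInequality

open scoped Pointwise

/-- The Brunn–Minkowski inequality for convex bodies in `m`-dimensional space. -/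
def BrunnMinkowski (m : ℕ) : Prop :=
  ∀ ⦃A B : Set (En m)⦄, Convex ℝ A → IsCompact A → Convex ℝ B → IsCompact B →
    A.Nonempty → B.Nonempty → ∀ α β : ℝ, 0 ≤ α → 0 ≤ β → α ^ m ≤ volume.real A →
    β ^ m ≤ volume.real B → (α + β) ^ m ≤ volume.real (A + B)

theorem Slicing.x_mem {m : ℕ} {K : Set (En m × ℝ)} (S : Slicing K) {τ : ℝ}
    (hτ : τ ∈ Set.Ioo (0 : ℝ) 1) : S.x τ ∈ Set.Ioo S.a S.b :=
  S.image_x ▸ Set.mem_image_of_mem S.x hτ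

/-- Volume of a Minkowski combination, bounded below by transporting slices onto slices of equal
volume fraction. -/
theorem lintegral_le_volume_add {m : ℕ} (hBM : BrunnMinkowski m) {K L : Set (En m × ℝ)}
    (hK : Convex ℝ K) (hKc : IsCompact K) (hL : Convex ℝ L) (hLc : IsCompact L)
    (S : Slicing K) (S' : Slicing L) {t : ℝ} (ht : 0 < t) :
    ∫⁻ τ in Set.Ioo 0 1, ENNReal.ofReal ((S.P τ + t * S'.P τ) ^ m *
      (volume.real K / S.P τ ^ m + t * (volume.real L / S'.P τ ^ m))) ≤ volume (K + t • L) := by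
  have hc : IsCompact (K + t • L) := hKc.add (hLc.smul t)
  let z : ℝ → ℝ := fun τ => S.x τ + t * S'.x τ
  let z' : ℝ → ℝ := fun τ => volume.real K / S.P τ ^ m + t * (volume.real L / S'.P τ ^ m)
  have hz : ∀ τ ∈ Set.Ioo (0 : ℝ) 1, HasDerivWithinAt z (z' τ) (Set.Ioo 0 1) τ := fun τ hτ =>
    ((S.hasDerivAt τ hτ).add ((S'.hasDerivAt τ hτ).const_mul t)).hasDerivWithinAt
  have hzm : StrictMonoOn z (Set.Ioo 0 1) := by
    intro τ hτ σ hσ h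
    have h1 := S.mono hτ hσ h
    have h2 := mul_lt_mul_of_pos_left (S'.mono hτ hσ h) ht
    exact add_lt_add h1 h2
  rw [volume_eq_lintegral_hslice hc]
  calc _ ≤ ∫⁻ τ in Set.Ioo 0 1, ENNReal.ofReal |z' τ| * volume (hslice (K + t • L) (z τ)) := by
        refine setLIntegral_mono' measurableSet_Ioo fun τ hτ => ?_
        have hP := S.P_pos τ hτ
        have hQ := S'.P_pos τ hτ
        have hz0 : 0 ≤ z' τ := by positivity
        rw [mul_comm, ENNReal.ofReal_mul hz0, abs_of_nonneg hz0]
        gcongr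
        have hne : ∀ {M : Set (En m × ℝ)} (T : Slicing M), (hslice M (T.x τ)).Nonempty := by
          intro M T
          by_contra hcon
          have h1 := T.P_pow τ hτ
          rw [Set.not_nonempty_iff_eq_empty.1 hcon] at h1
          simp only [measureReal_empty] at h1
          exact (pow_pos (T.P_pos τ hτ) m).ne' h1
        have hQ' : (t * S'.P τ) ^ m ≤ volume.real (t • hslice L (S'.x τ)) := by
          rw [mul_pow, S'.P_pow τ hτ, Measure.real, Measure.real, Measure.addHaar_smul,
            ENNReal.toReal_mul, finrank_euclideanSpace, Fintype.card_fin,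
            abs_of_pos (pow_pos ht m), ENNReal.toReal_ofReal (pow_nonneg ht.le m)]
        have key := hBM (convex_hslice hK (S.x τ)) (isCompact_hslice hKc (S.x τ))
          ((convex_hslice hL (S'.x τ)).smul t) ((isCompact_hslice hLc (S'.x τ)).smul t)
          (hne S) ((hne S').smul_set) (S.P τ) (t * S'.P τ) hP.le (by positivity)
          (S.P_pow τ hτ).le hQ'
        have hsub : hslice K (S.x τ) + t • hslice L (S'.x τ) ⊆ hslice (K + t • L) (z τ) := by
          rintro _ ⟨w, hw, _, ⟨v, hv, rfl⟩, rfl⟩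
          exact ⟨(w, S.x τ), hw, t • (v, S'.x τ), ⟨(v, S'.x τ), hv, rfl⟩, by simp [z]⟩
        rw [ENNReal.ofReal_le_iff_le_toReal (hslice_volume_ne_top hc _)]
        exact key.trans (ENNReal.toReal_mono (hslice_volume_ne_top hc _) (measure_mono hsub))
    _ = ∫⁻ s in z '' Set.Ioo 0 1, volume (hslice (K + t • L) s) :=
        (lintegral_image_eq_lintegral_abs_deriv_mul measurableSet_Ioo hz hzm.injOn
          fun s => volume (hslice (K + t • L) s)).symm
    _ ≤ _ := setLIntegral_le_lintegral _ _

theorem add_pow_succ_le {a b α β : ℝ} (ha : 0 < a) (hb : 0 < b) (hα : 0 ≤ α) (hβ : 0 ≤ β)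
    (m : ℕ) : (α + β) ^ (m + 1) ≤
      (a + b) ^ m * (α ^ (m + 1) / a ^ m + β ^ (m + 1) / b ^ m) := by
  have hab : 0 < a + b := add_pos ha hb
  have h := (convexOn_pow (𝕜 := ℝ) (m + 1)).2
    (show α / a ∈ Set.Ici (0 : ℝ) from Set.mem_Ici.2 (by positivity))
    (show β / b ∈ Set.Ici (0 : ℝ) from Set.mem_Ici.2 (by positivity))
    (show 0 ≤ a / (a + b) by positivity) (show 0 ≤ b / (a + b) by positivity)
    (show a / (a + b) + b / (a + b) = 1 by field_simp)
  simp only [smul_eq_mul] at h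
  have h1 : a / (a + b) * (α / a) + b / (a + b) * (β / b) = (α + β) / (a + b) := by
    field_simp
  rw [h1, div_pow, div_le_iff₀ (by positivity)] at h
  refine h.trans (le_of_eq ?_)
  rw [div_pow, div_pow]
  field_simp
  ring

theorem interior_nonempty_of_volume_pos {m : ℕ} {A : Set (En m)} (hA : Convex ℝ A)
    (h : 0 < volume.real A) : (interior A).Nonempty := by
  by_contra hcon
  have h1 : A ⊆ frontier A := by
    rw [frontier, Set.not_nonempty_iff_eq_empty.1 hcon, Set.sdiff_empty]
    exact subset_closure
  have h2 := measure_mono_null h1 (hA.addHaar_frontier volume)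
  rw [Measure.real, h2] at h
  simp at h

theorem volume_image_of_measurePreserving {m : ℕ} {Θ : En (m + 1) ≃L[ℝ] En m × ℝ}
    (hΘ : MeasurePreserving Θ volume volume) (A : Set (En (m + 1))) :
    volume (Θ '' A) = volume A := by
  have h := hΘ.measure_preimage_emb Θ.toHomeomorph.measurableEmbedding (Θ '' A)
  rw [← h, Set.preimage_image_eq _ Θ.injective]

theorem interior_image_nonempty {m : ℕ} (Θ : En (m + 1) ≃L[ℝ] En m × ℝ) {A : Set (En (m + 1))}
    (hA : (interior A).Nonempty) : (interior (Θ '' A)).Nonempty := by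
  have := Θ.toHomeomorph.image_interior A
  change Θ '' interior A = interior (Θ '' A) at this
  rw [← this]
  exact hA.image _

theorem volume_le_add_left {m : ℕ} {A B : Set (En m)} (hA : IsCompact A) (hB : IsCompact B)
    (hne : A.Nonempty) : volume.real B ≤ volume.real (A + B) := by
  obtain ⟨x, hx⟩ := hne
  refine ENNReal.toReal_mono (hA.add hB).measure_lt_top.ne ?_
  rw [← measure_preimage_add volume (-x) B]
  refine measure_mono fun y hy => ⟨x, hx, -x + y, hy, by simp⟩

theorem brunnMinkowski (m : ℕ) : BrunnMinkowski m := by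
  induction m with
  | zero =>
    intro A B hA hAc hB hBc hAn hBn α β hα hβ h1 h2
    have h3 := volume_le_add_left hAc hBc hAn
    simp only [pow_zero] at h2 ⊢
    exact h2.trans h3
  | succ m ih =>
    intro A B hA hAc hB hBc hAn hBn α β hα hβ h1 h2
    rcases hα.eq_or_lt with rfl | hα'
    · rw [zero_add]
      exact h2.trans (volume_le_add_left hAc hBc hAn)
    rcases hβ.eq_or_lt with rfl | hβ'
    · rw [add_zero, add_comm A B]
      exact h1.trans (volume_le_add_left hBc hAc hBn)
    have hAi := interior_nonempty_of_volume_pos hA (lt_of_lt_of_le (pow_pos hα' _) h1)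
    have hBi := interior_nonempty_of_volume_pos hB (lt_of_lt_of_le (pow_pos hβ' _) h2)
    obtain ⟨Θ, hΘ, -, -⟩ := exists_frame (EuclideanSpace.single (0 : Fin (m + 1)) (1 : ℝ))
      (by simp)
    have hconv : ∀ {C : Set (En (m + 1))}, Convex ℝ C → Convex ℝ (Θ '' C) := fun h =>
      h.linear_image Θ.toLinearEquiv.toLinearMap
    obtain ⟨S⟩ := nonempty_slicing (hconv hA) (hAc.image Θ.continuous)
      (interior_image_nonempty Θ hAi)
    obtain ⟨S'⟩ := nonempty_slicing (hconv hB) (hBc.image Θ.continuous)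
      (interior_image_nonempty Θ hBi)
    have h := lintegral_le_volume_add ih (hconv hA) (hAc.image Θ.continuous) (hconv hB)
      (hBc.image Θ.continuous) S S' one_pos
    have hreal : ∀ C : Set (En (m + 1)), volume.real (Θ '' C) = volume.real C := fun C => by
      rw [Measure.real, volume_image_of_measurePreserving hΘ, Measure.real]
    have himg : Θ '' (A + B) = Θ '' A + Θ '' B := Set.image_add Θ
    rw [one_smul, ← himg, volume_image_of_measurePreserving hΘ, hreal, hreal] at h
    rw [Measure.real, ← ENNReal.ofReal_le_iff_le_toReal (hAc.add hBc).measure_lt_top.ne]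
    refine le_trans ?_ h
    calc ENNReal.ofReal ((α + β) ^ (m + 1))
        = ∫⁻ τ in Set.Ioo (0 : ℝ) 1, ENNReal.ofReal ((α + β) ^ (m + 1)) := by simp
      _ ≤ _ := by
        refine setLIntegral_mono' measurableSet_Ioo fun τ hτ => ENNReal.ofReal_le_ofReal ?_
        have hP := S.P_pos τ hτ
        have hQ := S'.P_pos τ hτ
        refine (add_pow_succ_le hP hQ hα hβ m).trans ?_
        rw [one_mul, one_mul]
        gcongr

end BrunnMinkowskiInequality

section TransportEstimates

open scoped Pointwise

theorem one_add_mul_le_add_pow {p q t : ℝ} (hp : 0 < p) (hq : 0 < q) (ht : 0 < t) {v v' : ℝ}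
    (hv : 0 ≤ v) (hv' : 0 ≤ v') (m : ℕ) :
    v + t * (m * v * (q / p) + v' * (p / q) ^ m) ≤
      (p + t * q) ^ m * (v / p ^ m + t * (v' / q ^ m)) := by
  have h1 : 1 + (m : ℝ) * (t * (q / p)) ≤ (1 + t * (q / p)) ^ m :=
    one_add_mul_le_pow (by have : 0 ≤ t * (q / p) := by positivity
                           linarith) m
  have h2 : p ^ m ≤ (p + t * q) ^ m := by gcongr; nlinarith
  have h3 : (p + t * q) ^ m = p ^ m * (1 + t * (q / p)) ^ m := by
    rw [← mul_pow]; congr 1; field_simp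
  calc v + t * (m * v * (q / p) + v' * (p / q) ^ m)
      = v * (1 + (m : ℝ) * (t * (q / p))) + t * (v' / q ^ m) * p ^ m := by
        rw [div_pow]; field_simp; ring
    _ ≤ v * (1 + t * (q / p)) ^ m + t * (v' / q ^ m) * (p + t * q) ^ m := by gcongr
    _ = _ := by
      rw [mul_add]
      congr 1
      · rw [h3]; field_simp
      · ring

/-- First-order lower bound for the volume of `K + t L` in terms of the slicings. -/
theorem Slicing.mixed_lower_bound {m : ℕ} {K L : Set (En m × ℝ)}
    (hK : Convex ℝ K) (hKc : IsCompact K) (hL : Convex ℝ L) (hLc : IsCompact L)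
    (S : Slicing K) (S' : Slicing L) :
    IntegrableOn (fun τ => m * volume.real K * (S'.P τ / S.P τ) +
      volume.real L * (S.P τ / S'.P τ) ^ m) (Set.Ioo 0 1) ∧
    ∀ t : ℝ, 0 < t → t * ∫ τ in Set.Ioo 0 1, (m * volume.real K * (S'.P τ / S.P τ) +
      volume.real L * (S.P τ / S'.P τ) ^ m) ≤ volume.real (K + t • L) - volume.real K := by
  set g : ℝ → ℝ := fun τ => m * volume.real K * (S'.P τ / S.P τ) +
      volume.real L * (S.P τ / S'.P τ) ^ m with hg
  have hgc : ContinuousOn g (Set.Ioo 0 1) := by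
    have h1 := S'.P_cont.div S.P_cont fun τ hτ => (S.P_pos τ hτ).ne'
    have h2 := S.P_cont.div S'.P_cont fun τ hτ => (S'.P_pos τ hτ).ne'
    exact (continuousOn_const.mul h1).add (continuousOn_const.mul (h2.pow m))
  have hgm : AEStronglyMeasurable g (volume.restrict (Set.Ioo 0 1)) :=
    hgc.aestronglyMeasurable measurableSet_Ioo
  have hg0 : ∀ τ ∈ Set.Ioo (0 : ℝ) 1, 0 ≤ g τ := fun τ hτ => by
    have := S.P_pos τ hτ
    have := S'.P_pos τ hτ
    positivity
  have hfin : ∀ t : ℝ, volume (K + t • L) ≠ ∞ := fun t => (hKc.add (hLc.smul t)).measure_lt_top.ne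
  have key : ∀ t : ℝ, 0 < t →
      ∫⁻ τ in Set.Ioo 0 1, ENNReal.ofReal (volume.real K + t * g τ) ≤ volume (K + t • L) := by
    intro t ht
    refine le_trans ?_ (lintegral_le_volume_add (brunnMinkowski m) hK hKc hL hLc S S' ht)
    refine setLIntegral_mono' measurableSet_Ioo fun τ hτ => ENNReal.ofReal_le_ofReal ?_
    exact one_add_mul_le_add_pow (S.P_pos τ hτ) (S'.P_pos τ hτ) ht measureReal_nonneg
      measureReal_nonneg m
  have hint : IntegrableOn g (Set.Ioo 0 1) := by
    refine ⟨hgm, ?_⟩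
    rw [hasFiniteIntegral_iff_ofReal ((ae_restrict_iff' measurableSet_Ioo).2
      (Eventually.of_forall hg0))]
    refine lt_of_le_of_lt ?_ (hfin 1).lt_top
    refine le_trans ?_ (key 1 one_pos)
    refine lintegral_mono fun τ => ENNReal.ofReal_le_ofReal ?_
    have : 0 ≤ volume.real K := measureReal_nonneg
    linarith
  refine ⟨hint, fun t ht => ?_⟩
  have h := key t ht
  rw [← ofReal_integral_eq_lintegral_ofReal ((integrable_const _).fun_add (hint.const_mul t))
    ((ae_restrict_iff' measurableSet_Ioo).2 (Eventually.of_forall fun τ hτ => by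
      have := hg0 τ hτ
      positivity)), ENNReal.ofReal_le_iff_le_toReal (hfin t),
    integral_add (integrable_const _) (hint.const_mul t), integral_const_mul] at h
  simp only [integral_const, MeasurableSet.univ, measureReal_restrict_apply, Set.univ_inter,
    Real.volume_real_Ioo_of_le zero_le_one, sub_zero, one_smul] at h
  rw [Measure.real] at h ⊢
  linarith!

set_option maxHeartbeats 1000000 in
/-- Near-equality in both first-order mixed volume inequalities forces the transport between the
slicings to be nearly trivial. -/
theorem setIntegral_abs_mul_pow_sub_le {m : ℕ} (hm : 1 ≤ m) {q : ℝ → ℝ} {V W v₀ V₁ s S : ℝ}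
    (hq : ∀ τ ∈ Set.Ioo (0 : ℝ) 1, 0 < q τ) (hqc : ContinuousOn q (Set.Ioo 0 1))
    (hv₀ : 0 < v₀) (hV : v₀ ≤ V) (hV₁ : V ≤ V₁) (hW : v₀ ≤ W) (hW₁ : W ≤ V₁) (hs : 0 < s)
    (hsS : s ≤ S)
    (hAi : IntegrableOn (fun τ => m * V * (q τ)⁻¹ + W * q τ ^ m) (Set.Ioo 0 1))
    (hBi : IntegrableOn (fun τ => m * W * q τ + V * (q τ)⁻¹ ^ m) (Set.Ioo 0 1))
    (hA : ∫ τ in Set.Ioo 0 1, (m * V * (q τ)⁻¹ + W * q τ ^ m) ≤ (m + 1) * W + s ^ 2)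
    (hB : ∫ τ in Set.Ioo 0 1, (m * W * q τ + V * (q τ)⁻¹ ^ m) ≤ (m + 1) * V + s ^ 2) :
    IntegrableOn (fun τ => |W * q τ ^ m - V|) (Set.Ioo 0 1) ∧
    ∫ τ in Set.Ioo 0 1, |W * q τ ^ m - V| ≤
      (2 * V₁ * (1 / v₀ + 1 + S ^ 2 / v₀) + S + V₁ * (2 * S / v₀)) * s := by
  have hm' : (1 : ℝ) ≤ m := by exact_mod_cast hm
  have hV0 : 0 < V := hv₀.trans_le hV
  have hW0 : 0 < W := hv₀.trans_le hW
  have hae : ∀ {p : ℝ → Prop}, (∀ τ ∈ Set.Ioo (0 : ℝ) 1, p τ) →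
      ∀ᵐ τ ∂(volume.restrict (Set.Ioo (0 : ℝ) 1)), p τ := fun h =>
    (ae_restrict_iff' measurableSet_Ioo).2 (Eventually.of_forall h)
  have hi1 : IntegrableOn (fun τ => q τ ^ m) (Set.Ioo 0 1) := by
    refine Integrable.mono' (hAi.const_mul W⁻¹)
      ((hqc.pow m).aestronglyMeasurable measurableSet_Ioo) (hae fun τ hτ => ?_)
    have := hq τ hτ
    rw [Real.norm_of_nonneg (by positivity), mul_add, inv_mul_cancel_left₀ hW0.ne']
    have : 0 ≤ W⁻¹ * (m * V * (q τ)⁻¹) := by positivity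
    linarith
  have hi2 : IntegrableOn (fun τ => (q τ)⁻¹ ^ m) (Set.Ioo 0 1) := by
    refine Integrable.mono' (hBi.const_mul V⁻¹)
      (((hqc.inv₀ fun τ hτ => (hq τ hτ).ne').pow m).aestronglyMeasurable measurableSet_Ioo)
      (hae fun τ hτ => ?_)
    have := hq τ hτ
    rw [Real.norm_of_nonneg (by positivity), mul_add, inv_mul_cancel_left₀ hV0.ne']
    have : 0 ≤ V⁻¹ * (m * W * q τ) := by positivity
    linarith
  have hc : ∀ c : ℝ, IntegrableOn (fun _ => c) (Set.Ioo (0 : ℝ) 1) := fun c =>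
    integrable_const c
  have ia : ∀ {f g : ℝ → ℝ}, IntegrableOn f (Set.Ioo 0 1) → IntegrableOn g (Set.Ioo 0 1) →
      IntegrableOn (fun τ => f τ + g τ) (Set.Ioo 0 1) := fun hf hg => hf.add hg
  have is : ∀ {f g : ℝ → ℝ}, IntegrableOn f (Set.Ioo 0 1) → IntegrableOn g (Set.Ioo 0 1) →
      IntegrableOn (fun τ => f τ - g τ) (Set.Ioo 0 1) := fun hf hg => hf.sub hg
  have im : ∀ {f : ℝ → ℝ} (c : ℝ), IntegrableOn f (Set.Ioo 0 1) →
      IntegrableOn (fun τ => c * f τ) (Set.Ioo 0 1) := fun c hf => hf.const_mul c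
  have hci : ∀ c : ℝ, ∫ _ in Set.Ioo (0 : ℝ) 1, c = c := fun c => by simp
  set I := ∫ τ in Set.Ioo 0 1, q τ ^ m with hI
  set J := ∫ τ in Set.Ioo 0 1, (q τ)⁻¹ ^ m with hJ
  have hbern : ∀ x : ℝ, 0 < x → (m : ℝ) + 1 ≤ m * x⁻¹ + x ^ m := fun x hx => by
    have h1 : 1 + (m : ℝ) * (x - 1) ≤ (1 + (x - 1)) ^ m := one_add_mul_le_pow (by linarith) m
    rw [add_sub_cancel] at h1
    have h2 : 2 - x ≤ x⁻¹ := by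
      rw [← one_div, le_div_iff₀ hx]; nlinarith [sq_nonneg (x - 1)]
    nlinarith
  have hIJ : I + J - 2 ≤ s ^ 2 * (1 / W + 1 / V) := by
    have h1 : ∫ τ in Set.Ioo 0 1, (2 * (m : ℝ) + (q τ ^ m + (q τ)⁻¹ ^ m)) ≤
        ∫ τ in Set.Ioo 0 1, (W⁻¹ * (m * V * (q τ)⁻¹ + W * q τ ^ m) +
          V⁻¹ * (m * W * q τ + V * (q τ)⁻¹ ^ m)) := by
      refine setIntegral_mono_on (ia (hc _) (ia hi1 hi2))
        (ia (im _ hAi) (im _ hBi)) measurableSet_Ioo fun τ hτ => ?_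
      have hx := hq τ hτ
      have h2 : 2 ≤ V / (W * q τ) + W * q τ / V := by
        rw [div_add_div _ _ (by positivity) hV0.ne', le_div_iff₀ (by positivity)]
        nlinarith [sq_nonneg (V - W * q τ)]
      have h3 : W⁻¹ * (m * V * (q τ)⁻¹ + W * q τ ^ m) + V⁻¹ * (m * W * q τ + V * (q τ)⁻¹ ^ m)
          = m * (V / (W * q τ) + W * q τ / V) + (q τ ^ m + (q τ)⁻¹ ^ m) := by
        field_simp
        ring
      rw [h3]
      nlinarith
    rw [integral_add (hc _) (ia hi1 hi2), integral_add hi1 hi2,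
      integral_add (im _ hAi) (im _ hBi), hci, integral_const_mul, integral_const_mul] at h1
    have h4 := mul_le_mul_of_nonneg_left hA (inv_nonneg.2 hW0.le)
    have h5 := mul_le_mul_of_nonneg_left hB (inv_nonneg.2 hV0.le)
    have h6 : W⁻¹ * ((m + 1) * W + s ^ 2) + V⁻¹ * ((m + 1) * V + s ^ 2) =
        2 * m + 2 + s ^ 2 * (1 / W + 1 / V) := by field_simp; ring
    linarith
  set η := 2 * s ^ 2 / v₀ with hη
  have hη0 : 0 ≤ η := by positivity
  have hIJ' : I + J - 2 ≤ η := by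
    refine hIJ.trans ?_
    have h1 : 1 / W ≤ 1 / v₀ := one_div_le_one_div_of_le hv₀ hW
    have h2 : 1 / V ≤ 1 / v₀ := one_div_le_one_div_of_le hv₀ hV
    calc s ^ 2 * (1 / W + 1 / V) ≤ s ^ 2 * (1 / v₀ + 1 / v₀) := by gcongr
      _ = η := by rw [hη]; ring
  have hiE : IntegrableOn (fun τ => |q τ ^ m - 1|) (Set.Ioo 0 1) := (hi1.sub (hc 1)).abs
  set E := ∫ τ in Set.Ioo 0 1, |q τ ^ m - 1| with hE
  have hEbound : E ≤ (1 / v₀ + 1 + S ^ 2 / v₀) * s := by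
    have h1 : E ≤ ∫ τ in Set.Ioo 0 1, ((1 / (2 * s)) * (q τ ^ m + (q τ)⁻¹ ^ m - 2) +
        (s / 2) * (2 + (q τ ^ m + (q τ)⁻¹ ^ m - 2))) := by
      refine setIntegral_mono_on hiE (((is (ia hi1 hi2) (hc 2)).const_mul _).add
        (((hc 2).add (is (ia hi1 hi2) (hc 2))).const_mul _)) measurableSet_Ioo fun τ hτ => ?_
      have hx := pow_pos (hq τ hτ) m
      rw [inv_pow]
      set y := q τ ^ m
      have h2 : y + y⁻¹ - 2 = |y - 1| ^ 2 / y := by rw [sq_abs]; field_simp; ring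
      have h3 : y ≤ 2 + (y + y⁻¹ - 2) := by have := inv_pos.2 hx; linarith
      calc |y - 1| ≤ 1 / (2 * s) * (|y - 1| ^ 2 / y) + s / 2 * y := by
            rw [div_mul_div_comm, one_mul, ← sub_nonneg]
            have : |y - 1| ^ 2 / (2 * s * y) + s / 2 * y - |y - 1| =
              (|y - 1| - s * y) ^ 2 / (2 * s * y) := by field_simp; ring
            rw [this]
            positivity
        _ ≤ _ := by rw [← h2]; gcongr
    rw [integral_add (im _ (is (ia hi1 hi2) (hc 2)))
        (im _ (ia (hc 2) (is (ia hi1 hi2) (hc 2)))), integral_const_mul,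
      integral_const_mul, integral_add (hc 2) (is (ia hi1 hi2) (hc 2)),
      integral_sub (ia hi1 hi2) (hc 2), integral_add hi1 hi2, hci] at h1
    calc E ≤ 1 / (2 * s) * (I + J - 2) + s / 2 * (2 + (I + J - 2)) := h1
      _ ≤ 1 / (2 * s) * η + s / 2 * (2 + η) := by gcongr
      _ = (1 / v₀ + 1 + s ^ 2 / v₀) * s := by
        rw [hη]; field_simp; ring
      _ ≤ _ := by gcongr
  have hIE : |I - 1| ≤ E := by
    have : I - 1 = ∫ τ in Set.Ioo 0 1, (q τ ^ m - 1) := by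
      rw [integral_sub hi1 (hc 1), hci]
    rw [this]
    exact abs_integral_le_integral_abs
  have hA' : V * (m + 1 - I) + W * I ≤ (m + 1) * W + s ^ 2 := by
    have h1 : ∫ τ in Set.Ioo 0 1, (V * ((m + 1) - q τ ^ m) + W * q τ ^ m) ≤
        ∫ τ in Set.Ioo 0 1, (m * V * (q τ)⁻¹ + W * q τ ^ m) := by
      refine setIntegral_mono_on (ia (im _ (is (hc _) hi1)) (im _ hi1)) hAi
        measurableSet_Ioo fun τ hτ => ?_
      have := mul_le_mul_of_nonneg_left (hbern _ (hq τ hτ)) hV0.le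
      nlinarith
    rw [integral_add (im _ (is (hc _) hi1)) (im _ hi1), integral_const_mul,
      integral_const_mul, integral_sub (hc _) hi1, hci] at h1
    exact h1.trans hA
  have hB' : W * (m + 1 - J) + V * J ≤ (m + 1) * V + s ^ 2 := by
    have h1 : ∫ τ in Set.Ioo 0 1, (W * ((m + 1) - (q τ)⁻¹ ^ m) + V * (q τ)⁻¹ ^ m) ≤
        ∫ τ in Set.Ioo 0 1, (m * W * q τ + V * (q τ)⁻¹ ^ m) := by
      refine setIntegral_mono_on (ia (im _ (is (hc _) hi2)) (im _ hi2)) hBi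
        measurableSet_Ioo fun τ hτ => ?_
      have h2 := hbern _ (inv_pos.2 (hq τ hτ))
      rw [inv_inv] at h2
      have := mul_le_mul_of_nonneg_left h2 hW0.le
      nlinarith
    rw [integral_add (im _ (is (hc _) hi2)) (im _ hi2), integral_const_mul,
      integral_const_mul, integral_sub (hc _) hi2, hci] at h1
    exact h1.trans hB
  have hE0 : 0 ≤ E := (abs_nonneg _).trans hIE
  have hVW : |W - V| ≤ s ^ 2 + V₁ * (η + E) := by
    obtain ⟨hI1, hI2⟩ := abs_le.1 hIE
    have hV₁0 : 0 ≤ V₁ := hV0.le.trans hV₁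
    rw [abs_le]
    constructor
    · rcases le_total W V with h | h
      · have h1 : (V - W) * m ≤ s ^ 2 + (V - W) * (I - 1) := by linarith
        have h2 : (V - W) * (I - 1) ≤ V₁ * (η + E) :=
          (mul_le_mul_of_nonneg_left (by linarith : I - 1 ≤ η + E) (by linarith)).trans
            (mul_le_mul_of_nonneg_right (by linarith) (by linarith))
        nlinarith
      · have : 0 ≤ V₁ * (η + E) := by positivity
        nlinarith [sq_nonneg s]
    · rcases le_total V W with h | h
      · have h1 : (W - V) * m ≤ s ^ 2 + (W - V) * (J - 1) := by linarith
        have h2 : (W - V) * (J - 1) ≤ V₁ * (η + E) :=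
          (mul_le_mul_of_nonneg_left (by linarith : J - 1 ≤ η + E) (by linarith)).trans
            (mul_le_mul_of_nonneg_right (by linarith) (by linarith))
        nlinarith
      · have : 0 ≤ V₁ * (η + E) := by positivity
        nlinarith [sq_nonneg s]
  refine ⟨((hi1.const_mul W).sub (hc V)).abs, ?_⟩
  have hV₁0 : 0 ≤ V₁ := hV0.le.trans hV₁
  calc ∫ τ in Set.Ioo 0 1, |W * q τ ^ m - V|
      ≤ ∫ τ in Set.Ioo 0 1, (W * |q τ ^ m - 1| + |W - V|) := by
        refine setIntegral_mono_on ((hi1.const_mul W).sub (hc V)).abs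
          (ia (im W hiE) (hc _)) measurableSet_Ioo fun τ _ => ?_
        have h1 : W * q τ ^ m - V = W * (q τ ^ m - 1) + (W - V) := by ring
        rw [h1]
        refine (abs_add_le _ _).trans ?_
        rw [abs_mul, abs_of_pos hW0]
    _ = W * E + |W - V| := by
        rw [integral_add (im W hiE) (hc _), integral_const_mul, hci]
    _ ≤ V₁ * E + (s ^ 2 + V₁ * (η + E)) := by gcongr
    _ = 2 * V₁ * E + s * s + V₁ * (2 * s / v₀ * s) := by rw [hη]; ring
    _ ≤ 2 * V₁ * ((1 / v₀ + 1 + S ^ 2 / v₀) * s) + S * s + V₁ * (2 * S / v₀ * s) := by gcongr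
    _ = _ := by ring

/-- If slices at distance at least `d` from the extreme heights have volume at least `w`, then the
mean heights differ by at most the difference of the top heights up to a controlled error. -/
theorem Slicing.mean_sub_le {m : ℕ} {K L : Set (En m × ℝ)} (S : Slicing K) (S' : Slicing L)
    {d w : ℝ} (hd : 0 < d) (hw : 0 < w) (hab : S.a + d < S.b - d)
    (hP : ∀ τ ∈ Set.Ioo (0 : ℝ) 1, S.x τ ∈ Set.Icc (S.a + d) (S.b - d) → w ≤ S.P τ ^ m)
    (hint : IntegrableOn (fun τ => |volume.real L * (S.P τ / S'.P τ) ^ m - volume.real K|)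
      (Set.Ioo 0 1)) :
    ∫ τ in Set.Ioo 0 1, S'.x τ ≤ (∫ τ in Set.Ioo 0 1, S.x τ) + (S'.b - S.b + 2 * d +
      (∫ τ in Set.Ioo 0 1, |volume.real L * (S.P τ / S'.P τ) ^ m - volume.real K|) / w) := by
  set f : ℝ → ℝ := fun τ => |volume.real L * (S.P τ / S'.P τ) ^ m - volume.real K| with hf
  set G := (∫ τ in Set.Ioo 0 1, f τ) / w with hG
  have hG0 : 0 ≤ G := div_nonneg (integral_nonneg fun τ => abs_nonneg _) hw.le
  have hpre : ∀ s ∈ Set.Ioo S.a S.b, ∃ σ ∈ Set.Ioo (0 : ℝ) 1, S.x σ = s := fun s hs => by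
    rw [← S.image_x] at hs
    exact hs
  obtain ⟨α, hα, hαx⟩ := hpre (S.a + d) ⟨by linarith, by linarith⟩
  obtain ⟨β, hβ, hβx⟩ := hpre (S.b - d) ⟨by linarith, by linarith⟩
  have hend : ∀ τ ∈ Set.Ioo (0 : ℝ) 1, S.b - d ≤ S.x τ → S'.x τ - S.x τ ≤ S'.b - S.b + d :=
    fun τ hτ h => by have := (S'.x_mem hτ).2; linarith
  have hcd : ∀ {M : Set (En m × ℝ)} (T : Slicing M), ContinuousOn (fun τ => volume.real M / T.P τ ^ m)
      (Set.Ioo 0 1) := fun T =>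
    continuousOn_const.div (T.P_cont.pow m) fun τ hτ => (pow_pos (T.P_pos τ hτ) m).ne'
  have hmid : ∀ τ ∈ Set.Ioo (0 : ℝ) 1, S.x τ ∈ Set.Icc (S.a + d) (S.b - d) →
      S'.x τ - S.x τ ≤ S'.b - S.b + d + G := by
    intro τ hτ h
    have hτβ : τ ≤ β := (S.mono.le_iff_le hτ hβ).1 (hβx ▸ h.2)
    have hsub : Set.Icc τ β ⊆ Set.Ioo 0 1 := fun σ hσ => ⟨hτ.1.trans_le hσ.1, hσ.2.trans_lt hβ.2⟩
    have hsub' : Set.Ioc τ β ⊆ Set.Ioo 0 1 := Set.Ioc_subset_Icc_self.trans hsub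
    have hii : IntervalIntegrable (fun σ => volume.real K / S.P σ ^ m - volume.real L / S'.P σ ^ m)
        volume τ β := by
      apply ContinuousOn.intervalIntegrable
      rw [Set.uIcc_of_le hτβ]
      exact ((hcd S).sub (hcd S')).mono hsub
    have hftc := intervalIntegral.integral_eq_sub_of_hasDerivAt
      (f := fun σ => S.x σ - S'.x σ)
      (f' := fun σ => volume.real K / S.P σ ^ m - volume.real L / S'.P σ ^ m) (a := τ) (b := β)
      (fun σ hσ => by
        rw [Set.uIcc_of_le hτβ] at hσ
        exact (S.hasDerivAt σ (hsub hσ)).sub (S'.hasDerivAt σ (hsub hσ))) hii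
    have hle : ∫ σ in τ..β, (volume.real K / S.P σ ^ m - volume.real L / S'.P σ ^ m) ≤ G := by
      rw [intervalIntegral.integral_of_le hτβ]
      have h1 : IntegrableOn (fun σ => f σ / w) (Set.Ioo 0 1) := hint.div_const w
      calc _ ≤ ∫ σ in Set.Ioc τ β, f σ / w := by
            refine setIntegral_mono_on ((intervalIntegrable_iff_integrableOn_Ioc_of_le hτβ).1 hii)
              (h1.mono_set hsub') measurableSet_Ioc fun σ hσ => ?_
            have hσ' := hsub' hσ
            have hp := pow_pos (S.P_pos σ hσ') m
            have hq := pow_pos (S'.P_pos σ hσ') m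
            have hwP : w ≤ S.P σ ^ m := hP σ hσ'
              ⟨h.1.trans ((S.mono.le_iff_le hτ hσ').2 hσ.1.le),
                hβx ▸ (S.mono.le_iff_le hσ' hβ).2 hσ.2⟩
            have h2 : volume.real K / S.P σ ^ m - volume.real L / S'.P σ ^ m =
                -(volume.real L * (S.P σ / S'.P σ) ^ m - volume.real K) / S.P σ ^ m := by
              rw [div_pow]; field_simp; ring
            rw [h2]
            calc _ ≤ f σ / S.P σ ^ m := by gcongr; exact neg_le_abs _
              _ ≤ f σ / w := by gcongr
        _ ≤ ∫ σ in Set.Ioo 0 1, f σ / w :=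
            setIntegral_mono_set h1 (Eventually.of_forall fun σ => div_nonneg (abs_nonneg _) hw.le)
              (Eventually.of_forall hsub')
        _ = G := by rw [integral_div]
    have := hend β hβ hβx.ge
    rw [hftc] at hle
    linarith
  have hall : ∀ τ ∈ Set.Ioo (0 : ℝ) 1, S'.x τ ≤ S.x τ + (S'.b - S.b + 2 * d + G) := by
    intro τ hτ
    rcases le_total (S.b - d) (S.x τ) with h | h
    · have := hend τ hτ h
      linarith
    rcases le_total (S.a + d) (S.x τ) with h' | h'
    · have := hmid τ hτ ⟨h', h⟩
      linarith
    · have h1 : τ ≤ α := (S.mono.le_iff_le hτ hα).1 (hαx ▸ h')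
      have h2 := (S'.mono.le_iff_le hτ hα).2 h1
      have h3 := hmid α hα ⟨hαx.ge, by linarith⟩
      have h4 := (S.x_mem hτ).1
      linarith
  have hxi : ∀ {M : Set (En m × ℝ)} (T : Slicing M), IntegrableOn T.x (Set.Ioo 0 1) := by
    intro M T
    have hmeas : AEStronglyMeasurable T.x (volume.restrict (Set.Ioo 0 1)) :=
      ContinuousOn.aestronglyMeasurable
        (fun τ hτ => (T.hasDerivAt τ hτ).continuousAt.continuousWithinAt) measurableSet_Ioo
    exact Integrable.of_bound hmeas (max |T.a| |T.b|)
      ((ae_restrict_iff' measurableSet_Ioo).2 (Eventually.of_forall fun τ hτ =>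
        abs_le_max_abs_abs (T.x_mem hτ).1.le (T.x_mem hτ).2.le))
  have := setIntegral_mono_on (hxi S') ((hxi S).fun_add (integrable_const _)) measurableSet_Ioo hall
  rw [integral_add (hxi S) (integrable_const _)] at this
  simpa using this

end TransportEstimates

section SupportFunction

/-- The support function of a set. -/
def supp {n : ℕ} (K : Set (En n)) (u : En n) : ℝ := sSup ((fun x => ⟪x, u⟫_ℝ) '' K)

theorem isCompact_inner_image {n : ℕ} {K : Set (En n)} (hK : IsCompact K) (u : En n) :
    IsCompact ((fun x => ⟪x, u⟫_ℝ) '' K) := hK.image (by fun_prop)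

theorem inner_le_supp {n : ℕ} {K : Set (En n)} (hK : IsCompact K) {x : En n} (hx : x ∈ K)
    (u : En n) : ⟪x, u⟫_ℝ ≤ supp K u :=
  le_csSup (isCompact_inner_image hK u).bddAbove ⟨x, hx, rfl⟩

theorem exists_inner_eq_supp {n : ℕ} {K : Set (En n)} (hK : IsCompact K) (hne : K.Nonempty)
    (u : En n) : ∃ x ∈ K, ⟪x, u⟫_ℝ = supp K u :=
  (isCompact_inner_image hK u).sSup_mem (hne.image _)

theorem le_supp_of_closedBall_subset {n : ℕ} {K : Set (En n)} (hK : IsCompact K) {r : ℝ}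
    (hr : 0 ≤ r) (hrK : closedBall 0 r ⊆ K) {u : En n} (hu : ‖u‖ = 1) : r ≤ supp K u := by
  have h : r • u ∈ K := hrK (by simp [norm_smul, hu, abs_of_nonneg hr])
  have := inner_le_supp hK h u
  rwa [real_inner_smul_left, real_inner_self_eq_norm_sq, hu, one_pow, mul_one] at this

theorem abs_supp_sub_le {n : ℕ} {K : Set (En n)} (hK : IsCompact K) (hne : K.Nonempty) {R : ℝ}
    (hRK : K ⊆ closedBall 0 R) (u v : En n) : |supp K u - supp K v| ≤ R * ‖u - v‖ := by
  have key : ∀ u v : En n, supp K u - supp K v ≤ R * ‖u - v‖ := fun u v => by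
    obtain ⟨x, hx, hxu⟩ := exists_inner_eq_supp hK hne u
    have h1 := inner_le_supp hK hx v
    have h2 : ‖x‖ ≤ R := by simpa using hRK hx
    calc supp K u - supp K v ≤ ⟪x, u⟫_ℝ - ⟪x, v⟫_ℝ := by linarith
      _ = ⟪x, u - v⟫_ℝ := (inner_sub_right _ _ _).symm
      _ ≤ ‖x‖ * ‖u - v‖ := real_inner_le_norm _ _
      _ ≤ R * ‖u - v‖ := by gcongr
  rw [abs_le]
  have h1 := key u v
  have h2 := key v u
  rw [norm_sub_rev] at h2
  constructor <;> linarith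

theorem exists_dist_le_of_forall_inner_le {n : ℕ} {L : Set (En n)} (hL : Convex ℝ L)
    (hLc : IsCompact L) (hne : L.Nonempty) {x : En n} {D : ℝ} (hD : 0 ≤ D)
    (h : ∀ u : En n, ‖u‖ = 1 → ∃ y ∈ L, ⟪x, u⟫_ℝ ≤ ⟪y, u⟫_ℝ + D) : ∃ y ∈ L, dist x y ≤ D := by
  obtain ⟨y, hy, hyx⟩ := exists_norm_eq_iInf_of_complete_convex hne hLc.isComplete hL x
  refine ⟨y, hy, ?_⟩
  have hin := (norm_eq_iInf_iff_real_inner_le_zero hL hy).1 hyx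
  rw [dist_eq_norm]
  by_cases hxy : x - y = 0
  · rwa [hxy, norm_zero]
  have hpos : 0 < ‖x - y‖ := norm_pos_iff.2 hxy
  obtain ⟨z, hz, hzu⟩ := h (‖x - y‖⁻¹ • (x - y)) (by
    rw [norm_smul, norm_inv, norm_norm, inv_mul_cancel₀ hpos.ne'])
  have h1 := hin z hz
  rw [real_inner_smul_right, real_inner_smul_right] at hzu
  have h2 : ⟪x, x - y⟫_ℝ ≤ ⟪z, x - y⟫_ℝ + D * ‖x - y‖ := by
    have := mul_le_mul_of_nonneg_left hzu hpos.le
    rw [mul_add, mul_inv_cancel_left₀ hpos.ne', mul_inv_cancel_left₀ hpos.ne'] at this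
    linarith
  have h3 : ⟪x, x - y⟫_ℝ - ⟪z, x - y⟫_ℝ = ‖x - y‖ ^ 2 - ⟪x - y, z - y⟫_ℝ := by
    rw [← real_inner_self_eq_norm_sq, real_inner_comm (z - y), ← inner_sub_left, ← inner_sub_left]
    congr 1
    abel
  nlinarith

theorem transHausdorffDist_le {n : ℕ} {K L : Set (En n)} (hK : Convex ℝ K) (hKc : IsCompact K)
    (hKn : K.Nonempty) (hL : Convex ℝ L) (hLc : IsCompact L) (hLn : L.Nonempty) {b : En n} {D : ℝ}
    (hD : 0 ≤ D) (h : ∀ u : En n, ‖u‖ = 1 → |supp L u + ⟪b, u⟫_ℝ - supp K u| ≤ D) :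
    transHausdorffDist K L ≤ D := by
  refine (ciInf_le ⟨0, ?_⟩ b).trans ?_
  · rintro _ ⟨x, rfl⟩
    exact hausdorffDist_nonneg
  have hL' : Convex ℝ ((fun y => y + b) '' L) := by
    simpa only [add_comm b] using hL.translate b
  have hLc' : IsCompact ((fun y => y + b) '' L) := hLc.image (by fun_prop)
  refine hausdorffDist_le_of_mem_dist hD (fun x hx => ?_) ?_
  · refine exists_dist_le_of_forall_inner_le hL' hLc' (hLn.image _) hD fun u hu => ?_
    obtain ⟨y, hy, hyu⟩ := exists_inner_eq_supp hLc hLn u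
    refine ⟨_, ⟨y, hy, rfl⟩, ?_⟩
    have := inner_le_supp hKc hx u
    rw [inner_add_left, hyu]
    linarith [(abs_le.1 (h u hu)).1]
  · rintro _ ⟨x, hx, rfl⟩
    refine exists_dist_le_of_forall_inner_le hK hKc hKn hD fun u hu => ?_
    obtain ⟨y, hy, hyu⟩ := exists_inner_eq_supp hKc hKn u
    refine ⟨y, hy, ?_⟩
    have := inner_le_supp hLc hx u
    rw [inner_add_left, hyu]
    linarith [(abs_le.1 (h u hu)).2]

end SupportFunction

section Barycenters

open scoped Pointwise

/-- The barycenter of a body. -/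
def bary {n : ℕ} (K : Set (En n)) : En n := (volume.real K)⁻¹ • ∫ z in K, z

variable {m : ℕ} {K L : Set (En (m + 1))} {Θ : En (m + 1) ≃L[ℝ] En m × ℝ} {u : En (m + 1)}

theorem Slicing.b_eq_supp (S : Slicing (Θ '' K)) (h2 : ∀ z, (Θ z).2 = ⟪z, u⟫_ℝ) :
    S.b = supp K u := by
  have h := S.snd_image
  rw [Set.image_image] at h
  simp only [h2] at h
  rw [supp, h, csSup_Icc S.hab.le]

theorem Slicing.mean_eq_inner_bary (hKc : IsCompact K) (S : Slicing (Θ '' K))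
    (hΘ : MeasurePreserving Θ volume volume) (h2 : ∀ z, (Θ z).2 = ⟪z, u⟫_ℝ) :
    ∫ τ in Set.Ioo 0 1, S.x τ = ⟪bary K, u⟫_ℝ := by
  rw [S.mean, hΘ.setIntegral_image_emb Θ.toHomeomorph.measurableEmbedding, Measure.real,
    volume_image_of_measurePreserving hΘ, bary, real_inner_smul_left, div_eq_inv_mul]
  congr 1
  simp only [h2, real_inner_comm u]
  exact integral_inner (𝕜 := ℝ) (f := fun z : En (m + 1) => z)
    (ContinuousOn.integrableOn_compact hKc continuousOn_id) u

theorem Slicing.le_P_pow (hK : Convex ℝ K) (hKc : IsCompact K) (S : Slicing (Θ '' K))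
    (hu : ‖u‖ = 1) (h2 : ∀ z, (Θ z).2 = ⟪z, u⟫_ℝ) (hn : ∀ z, ‖z‖ ^ 2 = ‖(Θ z).1‖ ^ 2 + (Θ z).2 ^ 2)
    {r R d : ℝ} (hr : 0 < r) (hrK : closedBall 0 r ⊆ K) (hRK : K ⊆ closedBall 0 R) (hd : 0 < d) :
    (S.a + r ≤ 0 ∧ r ≤ S.b) ∧
    ∀ τ ∈ Set.Ioo (0 : ℝ) 1, S.x τ ∈ Set.Icc (S.a + d) (S.b - d) →
      (d / R) ^ m * volume.real (closedBall (0 : En m) r) ≤ S.P τ ^ m := by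
  have hmem : ∀ z ∈ K, (Θ z).2 ∈ Set.Icc S.a S.b := fun z hz => by
    rw [← S.snd_image]
    exact ⟨Θ z, ⟨z, hz, rfl⟩, rfl⟩
  have hab : ∀ s ∈ Set.Icc S.a S.b, ∃ w, (w, s) ∈ Θ '' K ∧ |s| ≤ R := fun s hs => by
    rw [← S.snd_image] at hs
    obtain ⟨_, ⟨z, hz, rfl⟩, rfl⟩ := hs
    refine ⟨(Θ z).1, ⟨z, hz, rfl⟩, ?_⟩
    have h3 : ‖z‖ ≤ R := by simpa using hRK hz
    refine le_trans (abs_le_of_sq_le_sq ?_ (norm_nonneg z)) h3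
    rw [hn z]
    nlinarith [sq_nonneg ‖(Θ z).1‖]
  have hc : ∀ c : ℝ, |c| ≤ r → c ∈ Set.Icc S.a S.b := fun c hc => by
    have := hmem (c • u) (hrK (by simpa [norm_smul, hu] using hc))
    rwa [h2, real_inner_smul_left, real_inner_self_eq_norm_sq, hu, one_pow, mul_one] at this
  have h1 := hc r (by rw [abs_of_pos hr])
  have h3 := hc (-r) (by rw [abs_neg, abs_of_pos hr])
  refine ⟨⟨by linarith [h3.1], h1.2⟩, fun τ hτ hx => ?_⟩
  obtain ⟨wa, hwa, ha⟩ := hab S.a (Set.left_mem_Icc.2 S.hab.le)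
  obtain ⟨wb, hwb, hb⟩ := hab S.b (Set.right_mem_Icc.2 S.hab.le)
  have ha0 : S.a < 0 := by linarith [h3.1]
  have hb0 : 0 < S.b := by linarith [h1.2]
  rw [abs_of_neg ha0] at ha
  rw [abs_of_pos hb0] at hb
  have hR : 0 < R := hb0.trans_le hb
  have hKΘ : Convex ℝ (Θ '' K) := hK.linear_image Θ.toLinearEquiv.toLinearMap
  have hKΘc : IsCompact (Θ '' K) := hKc.image Θ.continuous
  rw [S.P_pow τ hτ]
  have h0 : volume.real (closedBall (0 : En m) r) ≤ volume.real (hslice (Θ '' K) 0) := by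
    refine ENNReal.toReal_mono (hslice_volume_ne_top hKΘc _) (measure_mono fun w hw => ?_)
    refine ⟨Θ.symm (w, 0), hrK ?_, Θ.apply_symm_apply _⟩
    have h4 := hn (Θ.symm (w, 0))
    rw [Θ.apply_symm_apply] at h4
    simp only [ne_eq, OfNat.ofNat_ne_zero, not_false_eq_true, zero_pow, add_zero] at h4
    have h5 : ‖Θ.symm (w, 0)‖ = ‖w‖ := (sq_eq_sq₀ (norm_nonneg _) (norm_nonneg _)).1 h4
    simpa [h5] using hw
  have fin : ∀ θ e : ℝ, (∃ w, (w, e) ∈ Θ '' K) → 0 ≤ θ → d / R ≤ 1 - θ → θ * e = S.x τ →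
      (d / R) ^ m * volume.real (closedBall (0 : En m) r) ≤
        volume.real (hslice (Θ '' K) (S.x τ)) := by
    rintro θ e ⟨w, hw⟩ hθ hθ1 hθe
    have h4 : 0 < d / R := div_pos hd hR
    have h6 := hslice_homothety (s₀ := 0) hKΘ hKΘc hw hθ (by linarith)
    rw [mul_zero, zero_add, hθe] at h6
    refine le_trans ?_ h6
    have := pow_le_pow_left₀ h4.le hθ1 m
    gcongr
    exact (pow_pos h4 m).le.trans this
  rcases le_total 0 (S.x τ) with h | h
  · refine fin (S.x τ / S.b) S.b ⟨wb, hwb⟩ (by positivity) ?_ (by field_simp)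
    have : 1 - S.x τ / S.b = (S.b - S.x τ) / S.b := by field_simp
    rw [this]
    exact div_le_div₀ (by linarith [hx.2]) (by linarith [hx.2]) hb0 hb
  · refine fin (S.x τ / S.a) S.a ⟨wa, hwa⟩ (div_nonneg_of_nonpos h ha0.le) ?_
      (div_mul_cancel₀ _ ha0.ne)
    have : 1 - S.x τ / S.a = (S.x τ - S.a) / (-S.a) := by
      have := ha0.ne
      field_simp
      ring
    rw [this]
    exact div_le_div₀ (by linarith [hx.1]) (by linarith [hx.1]) (by linarith) ha

/-- Approximate equality in both Minkowski inequalities controls the difference of the support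
functions relative to the barycenters. -/
theorem inner_bary_le (hm : 1 ≤ m) (hK : Convex ℝ K) (hKc : IsCompact K) (hL : Convex ℝ L)
    (hLc : IsCompact L) {r R s S d : ℝ} (hr : 0 < r) (hrK : closedBall 0 r ⊆ K)
    (hRK : K ⊆ closedBall 0 R) (hrL : closedBall 0 r ⊆ L) (hRL : L ⊆ closedBall 0 R)
    (hs : 0 < s) (hsS : s ≤ S)
    (hKL : ∀ J : ℝ, (∀ t : ℝ, 0 < t → t * J ≤ volume.real (K + t • L) - volume.real K) →
      J ≤ (m + 1) * volume.real L + s ^ 2)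
    (hLK : ∀ J : ℝ, (∀ t : ℝ, 0 < t → t * J ≤ volume.real (L + t • K) - volume.real L) →
      J ≤ (m + 1) * volume.real K + s ^ 2)
    (hd : 0 < d) (hdr : d < r) (hu : ‖u‖ = 1) :
    ⟪bary L, u⟫_ℝ ≤ ⟪bary K, u⟫_ℝ + (supp L u - supp K u + 2 * d +
      (2 * volume.real (closedBall (0 : En (m + 1)) R) *
          (1 / volume.real (closedBall (0 : En (m + 1)) r) + 1 +
            S ^ 2 / volume.real (closedBall (0 : En (m + 1)) r)) + S +
        volume.real (closedBall (0 : En (m + 1)) R) *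
          (2 * S / volume.real (closedBall (0 : En (m + 1)) r))) * s /
        ((d / R) ^ m * volume.real (closedBall (0 : En m) r))) := by
  obtain ⟨Θ, hΘ, h2, hn⟩ := exists_frame u hu
  have hconv : ∀ {C : Set (En (m + 1))}, Convex ℝ C → Convex ℝ (Θ '' C) := fun h =>
    h.linear_image Θ.toLinearEquiv.toLinearMap
  have hint : ∀ {C : Set (En (m + 1))}, closedBall 0 r ⊆ C → (interior (Θ '' C)).Nonempty :=
    fun h => interior_image_nonempty Θ
      ⟨0, interior_mono h (ball_subset_interior_closedBall (mem_ball_self hr))⟩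
  have hreal : ∀ C : Set (En (m + 1)), volume.real (Θ '' C) = volume.real C := fun C => by
    rw [Measure.real, volume_image_of_measurePreserving hΘ, Measure.real]
  have himg : ∀ (A B : Set (En (m + 1))) (t : ℝ), Θ '' A + t • (Θ '' B) = Θ '' (A + t • B) :=
    fun A B t => by
      rw [Set.image_add Θ, ← Set.image_smul, ← Set.image_smul, Set.image_image, Set.image_image]
      simp
  obtain ⟨A⟩ := nonempty_slicing (hconv hK) (hKc.image Θ.continuous) (hint hrK)
  obtain ⟨B⟩ := nonempty_slicing (hconv hL) (hLc.image Θ.continuous) (hint hrL)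
  obtain ⟨hi1, hb1⟩ := A.mixed_lower_bound (hconv hK) (hKc.image Θ.continuous) (hconv hL)
    (hLc.image Θ.continuous) B
  obtain ⟨hi2, hb2⟩ := B.mixed_lower_bound (hconv hL) (hLc.image Θ.continuous) (hconv hK)
    (hKc.image Θ.continuous) A
  simp only [himg, hreal] at hi1 hb1 hi2 hb2
  have hmono : ∀ {C D : Set (En (m + 1))}, IsCompact D → C ⊆ D → volume.real C ≤ volume.real D :=
    fun hD h => ENNReal.toReal_mono hD.measure_lt_top.ne (measure_mono h)
  have hball : ∀ {k : ℕ}, 0 < volume.real (closedBall (0 : En k) r) := fun {k} =>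
    ENNReal.toReal_pos (measure_closedBall_pos volume _ hr).ne'
      (isCompact_closedBall _ _).measure_lt_top.ne
  have hq : ∀ τ ∈ Set.Ioo (0 : ℝ) 1, 0 < A.P τ / B.P τ := fun τ hτ =>
    div_pos (A.P_pos τ hτ) (B.P_pos τ hτ)
  obtain ⟨hi, hκ⟩ := setIntegral_abs_mul_pow_sub_le (q := fun τ => A.P τ / B.P τ)
    (V := volume.real K) (W := volume.real L) hm hq
    (A.P_cont.div B.P_cont fun τ hτ => (B.P_pos τ hτ).ne') hball
    (hmono hKc hrK) (hmono (isCompact_closedBall _ _) hRK) (hmono hLc hrL)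
    (hmono (isCompact_closedBall _ _) hRL) hs hsS (by simpa only [inv_div] using hi1)
    (by simpa only [inv_div] using hi2) (by simpa only [inv_div] using hKL _ hb1)
    (by simpa only [inv_div] using hLK _ hb2)
  obtain ⟨⟨ha, hb⟩, hP⟩ := A.le_P_pow hK hKc hu h2 hn hr hrK hRK hd
  have hR : 0 < R := by
    have h3 : ‖r • u‖ ≤ R := by
      simpa using hRK (hrK (by simp [norm_smul, hu, abs_of_pos hr] : r • u ∈ closedBall 0 r))
    rw [norm_smul, hu, Real.norm_of_nonneg hr.le, mul_one] at h3
    linarith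
  have hw : 0 < (d / R) ^ m * volume.real (closedBall (0 : En m) r) :=
    mul_pos (pow_pos (div_pos hd hR) m) hball
  have hfin := A.mean_sub_le B hd hw (by linarith) hP (by simpa only [hreal] using hi)
  rw [A.mean_eq_inner_bary hKc hΘ h2, B.mean_eq_inner_bary hLc hΘ h2, A.b_eq_supp h2,
    B.b_eq_supp h2, hreal, hreal] at hfin
  refine hfin.trans ?_
  gcongr

end Barycenters

section ReverseSphericalImage

/-- The reverse spherical image: the boundary points of `K` with an outer unit normal in `F`. -/
def revSph {n : ℕ} (K : Set (En n)) (F : Set (Sph n)) : Set (En n) :=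
  {x ∈ frontier K | ∃ u ∈ F, ∀ y ∈ K, ⟪y - x, (u : En n)⟫_ℝ ≤ 0}

theorem exists_hausdorffMeasure_eq (m : ℕ) :
    ∃ c : ℝ≥0, 0 < c ∧ ∀ A : Set (En m), μH[(m : ℝ)] A = c * volume A := by
  have h := Measure.isAddLeftInvariant_eq_smul (μH[(m : ℝ)] : Measure (En m)) volume
  refine ⟨Measure.addHaarScalarFactor (μH[(m : ℝ)] : Measure (En m)) volume,
    Measure.addHaarScalarFactor_pos_of_isAddHaarMeasure _ _, fun A => ?_⟩
  conv_lhs => rw [h]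
  rfl

theorem hausdorffMeasure_le_image_of_dist_le {X Y : Type*} [MetricSpace X] [MeasurableSpace X]
    [BorelSpace X] [MetricSpace Y] [MeasurableSpace Y] [BorelSpace Y] {f : X → Y} {A : Set X}
    {k : ℝ≥0} (h : ∀ x ∈ A, ∀ y ∈ A, dist x y ≤ k * dist (f x) (f y)) (m : ℕ) :
    μH[(m : ℝ)] A ≤ (k : ℝ≥0∞) ^ m * μH[(m : ℝ)] (f '' A) := by
  rcases A.eq_empty_or_nonempty with rfl | hA
  · simp
  have : Nonempty X := hA.to_type
  have hinj : Set.InjOn f A := fun x hx y hy hxy => by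
    have := h x hx y hy
    rw [hxy, dist_self, mul_zero] at this
    exact dist_le_zero.1 this
  have hL : LipschitzOnWith k (Function.invFunOn f A) (f '' A) := by
    refine LipschitzOnWith.of_dist_le_mul ?_
    rintro _ ⟨x, hx, rfl⟩ _ ⟨y, hy, rfl⟩
    rw [hinj.leftInvOn_invFunOn hx, hinj.leftInvOn_invFunOn hy]
    exact h x hx y hy
  have := hL.hausdorffMeasure_image_le (d := (m : ℝ)) (Nat.cast_nonneg m)
  rwa [hinj.leftInvOn_invFunOn.image_image, ENNReal.rpow_natCast] at this

theorem hausdorffMeasure_image_le_of_dist_le {X Y : Type*} [MetricSpace X] [MeasurableSpace X]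
    [BorelSpace X] [MetricSpace Y] [MeasurableSpace Y] [BorelSpace Y] {f : X → Y} (A : Set X)
    (h : ∀ x y, dist (f x) (f y) ≤ dist x y) (m : ℕ) :
    μH[(m : ℝ)] (f '' A) ≤ μH[(m : ℝ)] A := by
  have : LipschitzWith 1 f := LipschitzWith.of_dist_le_mul (by simpa only [NNReal.coe_one, one_mul] using h)
  simpa using this.hausdorffMeasure_image_le (d := (m : ℝ)) (Nat.cast_nonneg m) A

theorem revSph_iUnion {n : ℕ} {ι : Type*} (K : Set (En n)) (p : ι → Prop) (F : ι → Set (Sph n)) :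
    revSph K (⋃ (i) (_ : p i), F i) = ⋃ (i) (_ : p i), revSph K (F i) := by
  ext x
  simp only [revSph, Set.mem_iUnion, Set.mem_ofPred_eq]
  constructor
  · rintro ⟨hx, u, ⟨i, hi, hu⟩, h⟩
    exact ⟨i, hi, hx, u, hu, h⟩
  · rintro ⟨i, hi, hx, u, hu, h⟩
    exact ⟨hx, u, ⟨i, hi, hu⟩, h⟩

theorem isCompact_revSph {n : ℕ} {K : Set (En n)} (hK : IsCompact K) {F : Set (Sph n)}
    (hF : IsClosed F) : IsCompact (revSph K F) := by
  have hfr : IsCompact (frontier K) := hK.of_isClosed_subset isClosed_frontier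
    (frontier_subset_closure.trans hK.isClosed.closure_subset)
  have : revSph K F = Prod.fst '' ((frontier K ×ˢ F) ∩
      ⋂ y ∈ K, {p : En n × Sph n | ⟪y - p.1, (p.2 : En n)⟫_ℝ ≤ 0}) := by
    ext x
    simp only [revSph, Set.mem_image, Set.mem_inter_iff, Set.mem_prod, Set.mem_iInter, Prod.exists,
      Set.mem_ofPred_eq]
    constructor
    · rintro ⟨hx, u, hu, h⟩
      exact ⟨x, u, ⟨⟨hx, hu⟩, h⟩, rfl⟩
    · rintro ⟨x, u, ⟨⟨hx, hu⟩, h⟩, rfl⟩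
      exact ⟨hx, u, hu, h⟩
  rw [this]
  refine ((hfr.prod hF.isCompact).inter_right ?_).image continuous_fst
  refine isClosed_biInter fun y _ => isClosed_le ?_ continuous_const
  fun_prop

theorem abs_inner_sub_le_of_mem_revSph {n : ℕ} {K : Set (En n)} (hK : IsCompact K)
    {F : Set (Sph n)} {u : En n} {δ : ℝ} (hF : ∀ v ∈ F, ‖(v : En n) - u‖ ≤ δ) {x y : En n}
    (hx : x ∈ revSph K F) (hy : y ∈ revSph K F) : |⟪x - y, u⟫_ℝ| ≤ δ * ‖x - y‖ := by
  have hfr : ∀ {z}, z ∈ frontier K → z ∈ K := fun hz =>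
    hK.isClosed.closure_eq ▸ frontier_subset_closure hz
  have key : ∀ x y, x ∈ revSph K F → y ∈ revSph K F → ⟪x - y, u⟫_ℝ ≤ δ * ‖x - y‖ := by
    rintro x y ⟨hx, -⟩ ⟨_, v, hv, h⟩
    have h1 := h x (hfr hx)
    have h2 : ⟪x - y, u - v⟫_ℝ ≤ ‖x - y‖ * ‖u - v‖ := real_inner_le_norm _ _
    have h3 := mul_le_mul_of_nonneg_left (hF v hv) (norm_nonneg (x - y))
    rw [norm_sub_rev (v : En n) u] at h3
    rw [inner_sub_right] at h2
    linarith
  rw [abs_le]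
  have h1 := key x y hx hy
  have h2 := key y x hy hx
  rw [← neg_sub x y, inner_neg_left, norm_neg] at h2
  constructor <;> linarith

/-- Volume preserving coordinates with heights measured along `u`, in which the direction `l` is
vertical. -/
theorem exists_oblique_frame {m : ℕ} {u l : En (m + 1)} (hu : ‖u‖ = 1) {M : ℝ}
    (hl : 0 < ⟪l, u⟫_ℝ) (hM : ‖l‖ ≤ M * ⟪l, u⟫_ℝ) :
    ∃ Θ : En (m + 1) ≃L[ℝ] En m × ℝ, MeasurePreserving Θ volume volume ∧
      (∀ z, (Θ z).2 = ⟪z, u⟫_ℝ) ∧ (Θ l).1 = 0 ∧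
      ∀ z, ‖z‖ ≤ ‖(Θ z).1‖ + (1 + M) * |⟪z, u⟫_ℝ| := by
  obtain ⟨Θ, hΘ, h2, hn⟩ := exists_frame u hu
  have hfst : ∀ z, ‖(Θ z).1‖ ≤ ‖z‖ := fun z => by
    have := hn z
    exact abs_le_of_sq_le_sq' (by nlinarith [sq_nonneg (Θ z).2]) (norm_nonneg _) |>.2
  let κ : En m := (⟪l, u⟫_ℝ)⁻¹ • (Θ l).1
  have hκ : ‖κ‖ ≤ M := by
    rw [norm_smul, norm_inv, Real.norm_of_nonneg hl.le, inv_mul_le_iff₀ hl]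
    linarith [hfst l]
  let Ψ : (En m × ℝ) ≃L[ℝ] En m × ℝ :=
    ContinuousLinearEquiv.equivOfInverse
      ((ContinuousLinearMap.fst ℝ (En m) ℝ - (ContinuousLinearMap.snd ℝ (En m) ℝ).smulRight κ).prod
        (ContinuousLinearMap.snd ℝ (En m) ℝ))
      ((ContinuousLinearMap.fst ℝ (En m) ℝ + (ContinuousLinearMap.snd ℝ (En m) ℝ).smulRight κ).prod
        (ContinuousLinearMap.snd ℝ (En m) ℝ))
      (fun p => by ext <;> simp) (fun p => by ext <;> simp)
  have hΨ1 : ∀ p, Ψ p = (p.1 - p.2 • κ, p.2) := fun p => rfl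
  have hΨ : MeasurePreserving Ψ volume volume := by
    have hs : MeasurePreserving (fun p : ℝ × En m => (p.1, p.2 - p.1 • κ))
        (volume.prod volume) (volume.prod volume) := by
      refine (MeasurePreserving.id volume).skew_product (g := fun a w => w - a • κ) ?_ ?_
      · exact Continuous.measurable (by unfold Function.uncurry; fun_prop)
      · exact Eventually.of_forall fun a => (measurePreserving_sub_right volume (a • κ)).map_eq
    have := (Measure.measurePreserving_swap (μ := (volume : Measure ℝ))
      (ν := (volume : Measure (En m)))).comp (hs.comp (Measure.measurePreserving_swap
      (μ := (volume : Measure (En m))) (ν := (volume : Measure ℝ))))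
    exact this
  refine ⟨Θ.trans Ψ, hΨ.comp hΘ, fun z => ?_, ?_, fun z => ?_⟩
  · simp [hΨ1, h2]
  · simp [hΨ1, h2, κ, smul_smul, mul_inv_cancel₀ hl.ne']
  · have e : ((Θ.trans Ψ) z).1 = (Θ z).1 - ⟪z, u⟫_ℝ • κ := by simp [hΨ1, h2]
    rw [e]
    have h3 : ‖(Θ z).1‖ ≤ ‖(Θ z).1 - ⟪z, u⟫_ℝ • κ‖ + |⟪z, u⟫_ℝ| * M := by
      calc ‖(Θ z).1‖ = ‖((Θ z).1 - ⟪z, u⟫_ℝ • κ) + ⟪z, u⟫_ℝ • κ‖ := by rw [sub_add_cancel]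
        _ ≤ _ + ‖⟪z, u⟫_ℝ • κ‖ := norm_add_le _ _
        _ ≤ _ := by
          rw [norm_smul, Real.norm_eq_abs]
          gcongr
    have h4 : ‖z‖ ≤ ‖(Θ z).1‖ + |⟪z, u⟫_ℝ| := by
      have := hn z
      rw [h2, ← sq_abs ⟪z, u⟫_ℝ] at this
      exact abs_le_of_sq_le_sq' (by nlinarith [norm_nonneg (Θ z).1, abs_nonneg ⟪z, u⟫_ℝ])
        (by positivity) |>.2
    linarith

theorem dist_le_of_mem_revSph {m : ℕ} {K : Set (En (m + 1))} (hK : IsCompact K)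
    {F : Set (Sph (m + 1))} {u : En (m + 1)} {δ M : ℝ} (hF : ∀ v ∈ F, ‖(v : En (m + 1)) - u‖ ≤ δ)
    (hM : 0 ≤ M) (hδM : δ * (1 + M) < 1) {Θ : En (m + 1) ≃L[ℝ] En m × ℝ}
    (hΘ : ∀ z, ‖z‖ ≤ ‖(Θ z).1‖ + (1 + M) * |⟪z, u⟫_ℝ|) {x y : En (m + 1)}
    (hx : x ∈ revSph K F) (hy : y ∈ revSph K F) :
    dist x y ≤ (1 - δ * (1 + M))⁻¹ * dist (Θ x).1 (Θ y).1 := by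
  have h1 := abs_inner_sub_le_of_mem_revSph hK hF hx hy
  have h2 := hΘ (x - y)
  rw [map_sub, Prod.fst_sub, ← dist_eq_norm, ← dist_eq_norm] at h2
  rw [← dist_eq_norm] at h1
  rw [le_inv_mul_iff₀ (by linarith)]
  nlinarith [mul_le_mul_of_nonneg_left h1 (by linarith : (0 : ℝ) ≤ 1 + M)]

theorem isFiniteMeasure_of_revSph {m : ℕ} {K : Set (En (m + 1))} (hK : IsCompact K)
    {μ : Measure (Sph (m + 1))}
    (hμ : ∀ F : Set (Sph (m + 1)), MeasurableSet F → μ F = μH[(m : ℝ)] (revSph K F)) :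
    IsFiniteMeasure μ := by
  obtain ⟨c, hc, hH⟩ := exists_hausdorffMeasure_eq m
  have : IsLocallyFiniteMeasure μ := by
    refine ⟨fun u => ⟨closedBall u (1 / 4), closedBall_mem_nhds _ (by norm_num), ?_⟩⟩
    have hu : ‖(u : En (m + 1))‖ = 1 := by simp
    rw [hμ _ measurableSet_closedBall]
    obtain ⟨Θ, -, -, -, hΘ⟩ := exists_oblique_frame (l := (u : En (m + 1))) (M := 1) hu
      (by rw [real_inner_self_eq_norm_sq, hu]; norm_num)
      (by rw [real_inner_self_eq_norm_sq, hu]; norm_num)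
    have h := hausdorffMeasure_le_image_of_dist_le (f := fun z => (Θ z).1) (k := 2)
      (A := revSph K (closedBall u (1 / 4))) (fun x hx y hy => by
        have := dist_le_of_mem_revSph hK (F := closedBall u (1 / 4)) (δ := 1 / 4)
          (fun v hv => by rw [← dist_eq_norm]; exact hv) zero_le_one (by norm_num)
          hΘ hx hy
        norm_num at this ⊢
        exact this) m
    refine h.trans_lt (ENNReal.mul_lt_top (by simp) ?_)
    rw [hH]
    refine ENNReal.mul_lt_top (by simp) ?_
    exact ((isCompact_revSph hK isClosed_closedBall).image (by fun_prop)).measure_lt_top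
  infer_instance

theorem exists_partition {X : Type*} [MetricSpace X] [CompactSpace X] [Nonempty X]
    [MeasurableSpace X] [BorelSpace X] (μ : Measure X) [IsFiniteMeasure μ] {δ : ℝ} (hδ : 0 < δ) :
    ∃ (N : ℕ) (u : ℕ → X) (D : ℕ → Set X), (∀ i, MeasurableSet (D i)) ∧
      Pairwise (Function.onFun Disjoint D) ∧ ⋃ i ∈ Finset.range N, D i = Set.univ ∧
      (∀ i, μ (closure (D i)) = μ (D i)) ∧ ∀ i, ∀ v ∈ closure (D i), dist v (u i) ≤ δ := by
  let u := TopologicalSpace.denseSeq X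
  have hρ : ∀ i, ∃ ρ ∈ Set.Ioo (δ / 2) δ, μ (frontier (thickening ρ {u i})) = 0 := fun i =>
    exists_null_frontier_thickening μ {u i} (by linarith)
  choose ρ hρ h0 using hρ
  let U : ℕ → Set X := fun i => thickening (ρ i) {u i}
  have hU : ∀ i, U i = ball (u i) (ρ i) := fun i => thickening_singleton _ _
  have hcov : ⋃ i, U i = Set.univ := by
    refine Set.eq_univ_of_forall fun x => ?_
    obtain ⟨i, hi⟩ := (TopologicalSpace.denseRange_denseSeq X).exists_dist_lt x
      (by positivity : 0 < δ / 2)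
    refine Set.mem_iUnion.2 ⟨i, ?_⟩
    rw [hU]
    exact hi.trans (hρ i).1
  obtain ⟨T, hT⟩ := isCompact_univ.elim_finite_subcover U (fun i => isOpen_thickening)
    hcov.ge
  let N := T.sup id + 1
  have hfr : ∀ i, μ (frontier (disjointed U i)) = 0 := by
    refine fun i => disjointedRec (p := fun t => μ (frontier t) = 0) (fun t j ht => ?_) (h0 i)
    refine measure_mono_null ((frontier_inter_subset t (U j)ᶜ).trans (Set.union_subset_union
      Set.inter_subset_left Set.inter_subset_right)) ?_
    rw [frontier_compl]
    exact measure_union_null ht (h0 j)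
  refine ⟨N, u, disjointed U, fun i => MeasurableSet.disjointed
    (fun i => isOpen_thickening.measurableSet) i, disjoint_disjointed U, ?_, fun i => ?_,
    fun i v hv => ?_⟩
  · refine Set.eq_univ_of_forall fun x => ?_
    obtain ⟨i, hi, hx⟩ := Set.mem_iUnion₂.1 (hT (Set.mem_univ x))
    rw [biUnion_range_succ_disjointed]
    exact le_partialSups_of_le U (Finset.le_sup (f := id) hi) hx
  · refine le_antisymm ?_ (measure_mono subset_closure)
    rw [closure_eq_self_union_frontier]
    exact (measure_union_le _ _).trans (by rw [hfr, add_zero])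
  · have h1 : closure (disjointed U i) ⊆ closedBall (u i) (ρ i) :=
      closure_minimal (((disjointed_le U i).trans (hU i).le).trans ball_subset_closedBall)
        isClosed_closedBall
    exact (h1 hv).trans (hρ i).2.le

end ReverseSphericalImage

section MixedVolume

open scoped Pointwise

theorem volume_shell_ge {m : ℕ} {u l : En (m + 1)} {Θ : En (m + 1) ≃L[ℝ] En m × ℝ}
    (hΘ : MeasurePreserving Θ volume volume) (h2 : ∀ z, (Θ z).2 = ⟪z, u⟫_ℝ)
    (hl1 : (Θ l).1 = 0) (hl : 0 ≤ ⟪l, u⟫_ℝ) {C : Set (En (m + 1))} (hC : IsCompact C) {t : ℝ}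
    (ht : 0 ≤ t) :
    ENNReal.ofReal (t * ⟪l, u⟫_ℝ) * volume ((fun z => (Θ z).1) '' C) ≤
      volume ((fun p : En (m + 1) × ℝ => p.1 + p.2 • l) '' (C ×ˢ Set.Icc 0 t)) := by
  set S := (fun p : En (m + 1) × ℝ => p.1 + p.2 • l) '' (C ×ˢ Set.Icc 0 t) with hS
  have hSc : IsCompact S := (hC.prod isCompact_Icc).image (by fun_prop)
  have hSm : MeasurableSet (Θ '' S) := (hSc.image Θ.continuous).isClosed.measurableSet
  have hPm : MeasurableSet ((fun z => (Θ z).1) '' C) :=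
    (hC.image (by fun_prop)).isClosed.measurableSet
  rw [← volume_image_of_measurePreserving hΘ, Measure.volume_eq_prod, Measure.prod_apply hSm,
    ← lintegral_indicator_const hPm]
  refine lintegral_mono fun w => ?_
  by_cases hw : w ∈ (fun z => (Θ z).1) '' C
  · rw [Set.indicator_of_mem hw]
    obtain ⟨x, hx, rfl⟩ := hw
    have : Set.Icc (Θ x).2 ((Θ x).2 + t * ⟪l, u⟫_ℝ) ⊆ Prod.mk (Θ x).1 ⁻¹' (Θ '' S) := by
      intro a ha
      rcases hl.eq_or_lt with h0 | h0
      · rw [← h0, mul_zero, add_zero, Set.Icc_self] at ha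
        refine ⟨x, ⟨(x, 0), ⟨hx, le_rfl, ht⟩, by simp⟩, ?_⟩
        rw [ha]
      · refine ⟨x + ((a - (Θ x).2) / ⟪l, u⟫_ℝ) • l,
          ⟨(x, (a - (Θ x).2) / ⟪l, u⟫_ℝ), ⟨hx, ?_, ?_⟩, rfl⟩, ?_⟩
        · exact div_nonneg (by linarith [ha.1]) hl
        · rw [div_le_iff₀ h0]
          linarith [ha.2]
        · ext1
          · simp [hl1]
          · simp only [map_add, map_smul, Prod.snd_add, Prod.smul_snd, smul_eq_mul]
            rw [h2 l, div_mul_cancel₀ _ h0.ne']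
            ring
    calc _ = volume (Set.Icc (Θ x).2 ((Θ x).2 + t * ⟪l, u⟫_ℝ)) := by
          rw [Real.volume_Icc, add_sub_cancel_left]
      _ ≤ _ := measure_mono this
  · rw [Set.indicator_of_notMem hw]
    exact zero_le

theorem sum_le_of_shells {m : ℕ} {L : Set (En (m + 1))} (hL : Convex ℝ L) (hLc : IsCompact L)
    (h0 : 0 ∈ L) {R : ℝ} (hR : 0 < R) (hRL : L ⊆ closedBall 0 R) {N : ℕ} {C : ℕ → Set (En (m + 1))}
    (hC : ∀ i, IsCompact (C i)) (hCL : ∀ i, C i ⊆ L)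
    (hd : Pairwise (Function.onFun Disjoint C)) {l : ℕ → En (m + 1)} (hl : ∀ i, l i ∈ L)
    (hn : ∀ i, ∀ x ∈ C i, ∃ v : En (m + 1), ‖v‖ = 1 ∧ (∀ y ∈ L, ⟪y - x, v⟫_ℝ ≤ 0) ∧
      0 ≤ ⟪l i, v⟫_ℝ) {a : ℕ → ℝ} (ha : ∀ i, 0 ≤ a i)
    (h : ∀ i t, 0 ≤ t → ENNReal.ofReal (t * a i) ≤
      volume ((fun p : En (m + 1) × ℝ => p.1 + p.2 • l i) '' (C i ×ˢ Set.Icc 0 t))) :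
    ∑ i ∈ Finset.range N, a i ≤ (m + 1) * volume.real L := by
  let S : ℝ → ℕ → Set (En (m + 1)) := fun t i =>
    (fun p : En (m + 1) × ℝ => p.1 + p.2 • l i) '' (C i ×ˢ Set.Icc 0 t)
  have hSc : ∀ t i, IsCompact (S t i) := fun t i =>
    ((hC i).prod isCompact_Icc).image (by fun_prop)
  have hSth : ∀ t i, S t i ⊆ cthickening (t * R) (C i) := by
    rintro t i _ ⟨⟨x, s⟩, ⟨hx, hs⟩, rfl⟩
    refine mem_cthickening_of_dist_le _ x _ _ hx ?_
    have : ‖l i‖ ≤ R := by simpa using hRL (hl i)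
    simp only [dist_self_add_left, norm_smul, Real.norm_of_nonneg hs.1]
    exact mul_le_mul hs.2 this (norm_nonneg _) (hs.1.trans hs.2)
  have hSsub : ∀ t i, S t i ⊆ (1 + t) • L := by
    rintro t i _ ⟨⟨x, s⟩, ⟨hx, hs⟩, rfl⟩
    have hs0 : 0 ≤ s := hs.1
    have hst : s ≤ t := hs.2
    have ht0 : 0 ≤ t := hs0.trans hst
    have hx' : x + s • l i ∈ (1 + s) • L := by
      rw [hL.add_smul zero_le_one hs0, one_smul]
      exact Set.add_mem_add (hCL i hx) (Set.smul_mem_smul_set (hl i))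
    obtain ⟨y, hy, hyx⟩ := hx'
    refine ⟨((1 + s) / (1 + t)) • y, ?_, ?_⟩
    · refine hL.smul_mem_of_zero_mem h0 hy ⟨by positivity, ?_⟩
      rw [div_le_one (by linarith)]
      linarith
    · have : (1 + t) ≠ 0 := by linarith
      simp only [smul_smul]
      rw [mul_div_cancel₀ _ this]
      exact hyx
  have hSint : ∀ t i, Disjoint (S t i) (interior L) := by
    intro t i
    rw [Set.disjoint_left]
    rintro _ ⟨⟨x, s⟩, ⟨hx, hs⟩, rfl⟩ hint
    obtain ⟨v, hv, hvL, hvl⟩ := hn i x hx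
    obtain ⟨e, he, hb⟩ := Metric.isOpen_iff.1 isOpen_interior _ hint
    have hy : x + s • l i + (e / 2) • v ∈ L := interior_subset (hb (by
      rw [mem_ball, dist_self_add_left, norm_smul, hv, Real.norm_of_nonneg (by positivity)]
      linarith))
    have h1 := hvL _ hy
    rw [show x + s • l i + (e / 2) • v - x = s • l i + (e / 2) • v by abel, inner_add_left,
      real_inner_smul_left, real_inner_smul_left, real_inner_self_eq_norm_sq, hv] at h1
    have : 0 ≤ s * ⟪l i, v⟫_ℝ := mul_nonneg hs.1 hvl
    linarith
  have hfin : volume L ≠ ∞ := hLc.measure_lt_top.ne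
  have hint : volume (interior L) = volume L :=
    measure_interior_of_null_frontier (hL.addHaar_frontier volume)
  have hdj : ∀ᶠ t in 𝓝[>] (0 : ℝ), ∀ i ∈ Finset.range N, ∀ j ∈ Finset.range N, i ≠ j →
      Disjoint (S t i) (S t j) := by
    simp only [Filter.eventually_all_finset]
    intro i _ j _
    by_cases hij : i = j
    · simp [hij]
    obtain ⟨δ, hδ, hδd⟩ := (hd hij).exists_cthickenings (hC i) (hC j).isClosed
    filter_upwards [Ioo_mem_nhdsGT (div_pos hδ hR)] with t ht _
    have : t * R ≤ δ := by
      have := ht.2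
      rw [lt_div_iff₀ hR] at this
      exact this.le
    exact hδd.mono ((hSth t i).trans (cthickening_mono this _))
      ((hSth t j).trans (cthickening_mono this _))
  have hev : ∀ᶠ t in 𝓝[>] (0 : ℝ), ∑ i ∈ Finset.range N, a i ≤
      t⁻¹ • ((1 + (0 + t)) ^ (m + 1) * volume.real L - (1 + 0) ^ (m + 1) * volume.real L) := by
    filter_upwards [hdj, self_mem_nhdsWithin] with t htd ht
    have ht : 0 < t := ht
    have h1 : ENNReal.ofReal (∑ i ∈ Finset.range N, t * a i) + volume L ≤
        ENNReal.ofReal ((1 + t) ^ (m + 1)) * volume L := by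
      calc _ ≤ volume (⋃ i ∈ Finset.range N, S t i) + volume (interior L) := by
            rw [hint, measure_biUnion_finset (fun i hi j hj hij => htd i hi j hj hij)
              (fun i _ => (hSc t i).isClosed.measurableSet),
              ENNReal.ofReal_sum_of_nonneg (fun i _ => mul_nonneg ht.le (ha i))]
            gcongr with i
            exact h i t ht.le
        _ = volume ((⋃ i ∈ Finset.range N, S t i) ∪ interior L) := by
            refine (measure_union ?_ isOpen_interior.measurableSet).symm
            simp only [Set.disjoint_iUnion_left]
            exact fun i _ => hSint t i
        _ ≤ volume ((1 + t) • L) := by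
            refine measure_mono (Set.union_subset (Set.iUnion₂_subset fun i _ => hSsub t i) ?_)
            intro y hy
            refine ⟨(1 / (1 + t)) • y, hL.smul_mem_of_zero_mem h0 (interior_subset hy)
              ⟨by positivity, by rw [div_le_one (by linarith)]; linarith⟩, ?_⟩
            have : (1 + t) ≠ 0 := by linarith
            simp only [smul_smul]
            rw [mul_div_cancel₀ _ this, one_smul]
        _ = _ := by
            rw [Measure.addHaar_smul_of_nonneg volume (by linarith : 0 ≤ 1 + t)]
            simp
    have h2 := ENNReal.toReal_mono (by finiteness) h1
    rw [ENNReal.toReal_add (by finiteness) hfin, ENNReal.toReal_mul, ENNReal.toReal_ofReal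
      (Finset.sum_nonneg fun i _ => mul_nonneg ht.le (ha i)), ENNReal.toReal_ofReal (by positivity),
      ← Finset.mul_sum] at h2
    rw [smul_eq_mul, le_inv_mul_iff₀ ht]
    simp only [Measure.real, zero_add, add_zero, one_pow, one_mul]
    linarith
  have hder : HasDerivAt (fun t : ℝ => (1 + t) ^ (m + 1) * volume.real L)
      ((m + 1) * volume.real L) 0 := by
    have := (((hasDerivAt_id (0 : ℝ)).const_add 1).pow (m + 1)).mul_const (volume.real L)
    exact this.congr_deriv (by simp)
  exact ge_of_tendsto hder.tendsto_slope_zero_right hev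

theorem abs_integral_sub_sum_le {X : Type*} [MetricSpace X] [MeasurableSpace X] [BorelSpace X]
    {μ : Measure X} [IsFiniteMeasure μ] {f : X → ℝ} (hf : Integrable f μ) {N : ℕ} {u : ℕ → X}
    {D : ℕ → Set X} (hD : ∀ i, MeasurableSet (D i)) (hdisj : Pairwise (Function.onFun Disjoint D))
    (hcov : ⋃ i ∈ Finset.range N, D i = Set.univ) {a : ℝ}
    (h : ∀ i, ∀ v ∈ D i, |f v - f (u i)| ≤ a) :
    |∫ v, f v ∂μ - ∑ i ∈ Finset.range N, f (u i) * μ.real (D i)| ≤ a * μ.real Set.univ := by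
  have hu : μ.real Set.univ = ∑ i ∈ Finset.range N, μ.real (D i) := by
    rw [← hcov]
    exact measureReal_biUnion_finset (fun i _ j _ hij => hdisj hij) fun i _ => hD i
  have hs : ∫ v, f v ∂μ = ∑ i ∈ Finset.range N, ∫ v in D i, f v ∂μ := by
    rw [← integral_biUnion_finset _ (fun i _ => hD i) (fun i _ j _ hij => hdisj hij)
      (fun i _ => hf.integrableOn), hcov, Measure.restrict_univ]
  rw [hs, ← Finset.sum_sub_distrib, hu, Finset.mul_sum]
  refine (Finset.abs_sum_le_sum_abs _ _).trans (Finset.sum_le_sum fun i _ => ?_)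
  rw [show (∫ v in D i, f v ∂μ) - f (u i) * μ.real (D i) = ∫ v in D i, (f v - f (u i)) ∂μ by
    rw [integral_sub hf.integrableOn (integrable_const _), setIntegral_const, smul_eq_mul, mul_comm]]
  rw [← Real.norm_eq_abs]
  refine norm_setIntegral_le_of_norm_le_const (measure_lt_top μ _) fun v hv => ?_
  exact h i v hv

end MixedVolume

section MixedVolumeSelf

theorem continuous_supp {n : ℕ} {L : Set (En n)} (hL : IsCompact L) (hne : L.Nonempty) {R : ℝ}
    (hRL : L ⊆ closedBall 0 R) : Continuous (supp L) := by
  have hR : 0 ≤ R := by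
    obtain ⟨x, hx⟩ := hne
    exact dist_nonneg.trans (hRL hx)
  refine LipschitzWith.continuous (K := ⟨R, hR⟩) (LipschitzWith.of_dist_le_mul fun u v => ?_)
  rw [Real.dist_eq, dist_eq_norm]
  exact abs_supp_sub_le hL hne hRL u v

theorem integrable_supp {n : ℕ} {L : Set (En n)} (hL : IsCompact L) (hne : L.Nonempty) {R : ℝ}
    (hRL : L ⊆ closedBall 0 R) (μ : Measure (Sph n)) [IsFiniteMeasure μ] :
    Integrable (fun v : Sph n => supp L v) μ :=
  ((continuous_supp hL hne hRL).comp continuous_subtype_val).integrable_of_hasCompactSupport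
    (HasCompactSupport.of_compactSpace _)

theorem measure_le_hausdorffMeasure_sdiff {m : ℕ} {L : Set (En (m + 1))}
    {μ : Measure (Sph (m + 1))} [IsFiniteMeasure μ]
    (hμ : ∀ F : Set (Sph (m + 1)), MeasurableSet F → μ F = μH[(m : ℝ)] (revSph L F))
    {D : ℕ → Set (Sph (m + 1))} (hD : ∀ i, MeasurableSet (D i))
    (hdisj : Pairwise (Function.onFun Disjoint D)) (hcl : ∀ i, μ (closure (D i)) = μ (D i))
    (i : ℕ) :
    μ (D i) ≤ μH[(m : ℝ)] (revSph L (closure (D i)) \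
      ⋃ j ∈ Finset.range i, revSph L (closure (D j))) := by
  have hm : ∀ k, MeasurableSet (⋃ j ∈ Finset.range k, closure (D j)) := fun k =>
    Finset.measurableSet_biUnion _ fun j _ => isClosed_closure.measurableSet
  have e1 : ∀ k, μ (⋃ j ∈ Finset.range k, closure (D j)) =
      μH[(m : ℝ)] (⋃ j ∈ Finset.range k, revSph L (closure (D j))) := fun k => by
    rw [hμ _ (hm k), revSph_iUnion]
  have e2 : ∀ k, μ (⋃ j ∈ Finset.range k, closure (D j)) = μ (⋃ j ∈ Finset.range k, D j) := by
    refine fun k => le_antisymm ?_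
      (measure_mono (Set.iUnion₂_mono fun j _ => subset_closure))
    rw [measure_biUnion_finset (fun a _ b _ hab => hdisj hab) fun j _ => hD j]
    refine (measure_biUnion_finset_le _ _).trans (Finset.sum_le_sum fun j _ => (hcl j).le)
  have h1 : μ (D i) + μ (⋃ j ∈ Finset.range i, D j) ≤
      μH[(m : ℝ)] (revSph L (closure (D i)) \ ⋃ j ∈ Finset.range i, revSph L (closure (D j))) +
        μ (⋃ j ∈ Finset.range i, D j) := by
    calc _ = μ (⋃ j ∈ Finset.range (i + 1), D j) := by
          rw [measure_biUnion_finset (fun a _ b _ hab => hdisj hab) fun j _ => hD j,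
            measure_biUnion_finset (fun a _ b _ hab => hdisj hab) fun j _ => hD j,
            Finset.sum_range_succ, add_comm]
      _ = μH[(m : ℝ)] (⋃ j ∈ Finset.range (i + 1), revSph L (closure (D j))) := by rw [← e2, e1]
      _ ≤ μH[(m : ℝ)] ((revSph L (closure (D i)) \
            ⋃ j ∈ Finset.range i, revSph L (closure (D j))) ∪
            ⋃ j ∈ Finset.range i, revSph L (closure (D j))) := by
          refine measure_mono (Set.iUnion₂_subset fun j hj => ?_)
          rcases (Nat.lt_succ_iff.1 (Finset.mem_range.1 hj)).eq_or_lt with rfl | hj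
          · rw [Set.sdiff_union_self]
            exact Set.subset_union_left
          · exact Set.subset_union_of_subset_right
              (Set.subset_biUnion_of_mem (u := fun j => revSph L (closure (D j)))
                (Finset.mem_range.2 hj)) _
      _ ≤ _ := measure_union_le _ _
      _ = _ := by rw [← e1 i, e2]
  exact (ENNReal.add_le_add_iff_right (measure_ne_top _ _)).1 h1

theorem integral_supp_le_of_mesh {m : ℕ} {c : ℝ≥0}
    (hc : ∀ A : Set (En m), μH[(m : ℝ)] A = c * volume A) {L : Set (En (m + 1))}
    (hL : Convex ℝ L) (hLc : IsCompact L) {r R : ℝ} (hr : 0 < r) (hR : 0 < R)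
    (hrL : closedBall 0 r ⊆ L)
    (hRL : L ⊆ closedBall 0 R) {μ : Measure (Sph (m + 1))}
    (hμ : ∀ F : Set (Sph (m + 1)), MeasurableSet F → μ F = μH[(m : ℝ)] (revSph L F)) {δ : ℝ}
    (hδ : 0 < δ) (hδr : R * δ ≤ r) (hδR : δ * (1 + R / r) < 1) :
    ∫ v, supp L v ∂μ ≤ (1 - δ * (1 + R / r))⁻¹ ^ m * c * ((m + 1) * volume.real L) +
      R * δ * μ.real Set.univ := by
  have : IsFiniteMeasure μ := isFiniteMeasure_of_revSph hLc hμ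
  have : Nonempty (Sph (m + 1)) :=
    (NormedSpace.sphere_nonempty (x := (0 : En (m + 1))) (r := 1)).2 zero_le_one |>.to_subtype
  have h0L : (0 : En (m + 1)) ∈ L := hrL (by simpa using hr.le)
  have hne : L.Nonempty := ⟨0, h0L⟩
  obtain ⟨N, u, D, hD, hdisj, hcov, hcl, hu⟩ := exists_partition μ hδ
  have hu1 : ∀ i, ‖(u i : En (m + 1))‖ = 1 := fun i => by simp
  have hFu : ∀ i, ∀ v ∈ closure (D i), ‖(v : En (m + 1)) - u i‖ ≤ δ := fun i v hv => by
    rw [← dist_eq_norm]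
    exact hu i v hv
  choose l hlL hlu using fun i => exists_inner_eq_supp hLc hne (u i : En (m + 1))
  have hlR : ∀ i, ‖l i‖ ≤ R := fun i => by simpa using hRL (hlL i)
  have hh : ∀ i, r ≤ supp L (u i) := fun i => le_supp_of_closedBall_subset hLc hr.le hrL (hu1 i)
  have hfr := fun i => exists_oblique_frame (u := (u i : En (m + 1))) (l := l i) (M := R / r)
    (hu1 i) (by rw [hlu]; exact hr.trans_le (hh i)) (by
      rw [hlu]
      calc ‖l i‖ ≤ R / r * r := by rw [div_mul_cancel₀ _ hr.ne']; exact hlR i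
        _ ≤ _ := by gcongr; exact hh i)
  choose Θ hΘm hΘ2 hΘl hΘ using hfr
  set k : ℝ := (1 - δ * (1 + R / r))⁻¹ with hk
  have hk0 : 0 ≤ k := inv_nonneg.2 (by linarith)
  set A : ℕ → Set (En (m + 1)) := fun i => revSph L (closure (D i)) with hA
  have hAc : ∀ i, IsCompact (A i) := fun i => isCompact_revSph hLc isClosed_closure
  have hAL : ∀ i, A i ⊆ L := fun i x hx => hLc.isClosed.closure_eq ▸ frontier_subset_closure hx.1
  have key : ∀ η : ℝ, 0 < η →
      ∑ i ∈ Finset.range N, supp L (u i) * (μ.real (D i) - η) ≤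
        k ^ m * c * ((m + 1) * volume.real L) := by
    intro η hη
    have hC : ∀ i, ∃ C, C ⊆ A i \ (⋃ j ∈ Finset.range i, A j) ∧ IsCompact C ∧
        μ (D i) ≤ μH[(m : ℝ)] C + ENNReal.ofReal η := by
      intro i
      have hfin : μH[(m : ℝ)] (A i) < ∞ := by
        rw [← hμ _ isClosed_closure.measurableSet]
        exact measure_lt_top _ _
      have hfm : IsFiniteMeasure (μH[(m : ℝ)].restrict (A i)) := ⟨by simpa using hfin⟩
      have hBm : MeasurableSet (A i \ (⋃ j ∈ Finset.range i, A j)) :=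
        (hAc i).isClosed.measurableSet.diff
          (Finset.measurableSet_biUnion _ fun j _ => (hAc j).isClosed.measurableSet)
      obtain ⟨C, hCs, hCc, hClt⟩ := hBm.exists_isCompact_lt_add (μ := μH[(m : ℝ)].restrict (A i))
        (measure_ne_top _ _) (ENNReal.ofReal_pos.2 hη).ne'
      refine ⟨C, hCs, hCc, (measure_le_hausdorffMeasure_sdiff hμ hD hdisj hcl i).trans ?_⟩
      rw [Measure.restrict_apply hBm, Measure.restrict_apply hCc.isClosed.measurableSet,
        Set.inter_eq_left.2 Set.sdiff_subset, Set.inter_eq_left.2 (hCs.trans Set.sdiff_subset)]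
        at hClt
      exact hClt.le
    choose C hCs hCc hCμ using hC
    have hCA : ∀ i, C i ⊆ A i := fun i => (hCs i).trans Set.sdiff_subset
    have hPc : ∀ i, IsCompact ((fun z => (Θ i z).1) '' C i) := fun i => (hCc i).image (by fun_prop)
    have hsum := sum_le_of_shells hL hLc h0L hR hRL (N := N) hCc
      (fun i => (hCA i).trans (hAL i)) (by
        have : ∀ i j, i < j → Disjoint (C i) (C j) := fun i j hij => by
          rw [Set.disjoint_left]
          intro x hx hx'
          exact (hCs j hx').2 (Set.mem_biUnion (Finset.mem_coe.2 (Finset.mem_range.2 hij))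
            (hCA i hx))
        intro i j hij
        rcases lt_or_gt_of_ne hij with h | h
        · exact this i j h
        · exact (this j i h).symm) hlL
      (fun i x hx => by
        obtain ⟨-, v, hv, hvL⟩ := hCA i hx
        refine ⟨v, by simp, hvL, ?_⟩
        have h1 : ⟪l i, (u i : En (m + 1)) - v⟫_ℝ ≤ ‖l i‖ * ‖(u i : En (m + 1)) - v‖ :=
          real_inner_le_norm _ _
        have h2 : ‖l i‖ * ‖(u i : En (m + 1)) - v‖ ≤ R * δ := by
          rw [norm_sub_rev]
          exact mul_le_mul (hlR i) (hFu i v hv) (norm_nonneg _) hR.le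
        rw [inner_sub_right, hlu] at h1
        linarith [hh i])
      (a := fun i => supp L (u i) * volume.real ((fun z => (Θ i z).1) '' C i))
      (fun i => mul_nonneg (hr.le.trans (hh i)) measureReal_nonneg)
      (fun i t ht => by
        have := volume_shell_ge (hΘm i) (hΘ2 i) (hΘl i) (by rw [hlu]; linarith [hh i]) (hCc i) ht
        rw [hlu] at this
        refine le_trans (le_of_eq ?_) this
        rw [← mul_assoc, ENNReal.ofReal_mul (mul_nonneg ht (hr.le.trans (hh i))), Measure.real,
          ENNReal.ofReal_toReal (hPc i).measure_lt_top.ne])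
    have hone : ∀ i, μ.real (D i) - η ≤ k ^ m * c * volume.real ((fun z => (Θ i z).1) '' C i) := by
      intro i
      have h1 := hausdorffMeasure_le_image_of_dist_le (f := fun z => (Θ i z).1) (k := ⟨k, hk0⟩)
        (A := C i) (fun x hx y hy => dist_le_of_mem_revSph hLc (hFu i) (by positivity) hδR (hΘ i)
          (hCA i hx) (hCA i hy)) m
      rw [hc] at h1
      have h2 := (hCμ i).trans (add_le_add_left h1 _)
      have hf : volume ((fun z => (Θ i z).1) '' C i) ≠ ∞ := (hPc i).measure_lt_top.ne
      have h3 := ENNReal.toReal_mono (by finiteness) h2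
      rw [ENNReal.toReal_add (by finiteness) (by finiteness), ENNReal.toReal_mul,
        ENNReal.toReal_mul, ENNReal.toReal_pow, ENNReal.toReal_ofReal hη.le] at h3
      simp only [ENNReal.coe_toReal] at h3
      change (μ (D i)).toReal ≤
        k ^ m * (c * (volume ((fun z => (Θ i z).1) '' C i)).toReal) + η at h3
      simp only [Measure.real]
      linarith
    calc _ ≤ ∑ i ∈ Finset.range N, supp L (u i) *
          (k ^ m * c * volume.real ((fun z => (Θ i z).1) '' C i)) := by
          gcongr with i
          · exact hr.le.trans (hh i)
          · exact hone i
      _ = k ^ m * c * ∑ i ∈ Finset.range N, supp L (u i) *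
          volume.real ((fun z => (Θ i z).1) '' C i) := by
          rw [Finset.mul_sum]
          exact Finset.sum_congr rfl fun i _ => by ring
      _ ≤ _ := by gcongr
  have hlim : ∑ i ∈ Finset.range N, supp L (u i) * μ.real (D i) ≤
      k ^ m * c * ((m + 1) * volume.real L) := by
    have ht : Tendsto (fun η : ℝ => ∑ i ∈ Finset.range N, supp L (u i) * (μ.real (D i) - η))
        (𝓝[>] 0) (𝓝 (∑ i ∈ Finset.range N, supp L (u i) * (μ.real (D i) - 0))) :=
      ((by fun_prop : Continuous (fun η : ℝ => ∑ i ∈ Finset.range N,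
        supp L (u i) * (μ.real (D i) - η))).tendsto 0).mono_left nhdsWithin_le_nhds
    simp only [sub_zero] at ht
    exact le_of_tendsto ht (eventually_mem_nhdsWithin.mono fun η hη => key η hη)
  have hint := abs_integral_sub_sum_le (integrable_supp hLc hne hRL μ) (u := u) hD hdisj hcov
    (a := R * δ) (fun i v hv => (abs_supp_sub_le hLc hne hRL _ _).trans
      (mul_le_mul_of_nonneg_left (hFu i v (subset_closure hv)) hR.le))
  linarith [(abs_le.1 hint).2]

theorem integral_supp_le {m : ℕ} {c : ℝ≥0}
    (hc : ∀ A : Set (En m), μH[(m : ℝ)] A = c * volume A) {L : Set (En (m + 1))}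
    (hL : Convex ℝ L) (hLc : IsCompact L) {r R : ℝ} (hr : 0 < r) (hR : 0 < R)
    (hrL : closedBall 0 r ⊆ L)
    (hRL : L ⊆ closedBall 0 R) {μ : Measure (Sph (m + 1))}
    (hμ : ∀ F : Set (Sph (m + 1)), MeasurableSet F → μ F = μH[(m : ℝ)] (revSph L F)) :
    ∫ v, supp L v ∂μ ≤ c * ((m + 1) * volume.real L) := by
  have ht : Tendsto (fun δ : ℝ => (1 - δ * (1 + R / r))⁻¹ ^ m * c * ((m + 1) * volume.real L) +
      R * δ * μ.real Set.univ) (𝓝[>] 0) (𝓝 ((1 - 0 * (1 + R / r))⁻¹ ^ m * c *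
        ((m + 1) * volume.real L) + R * 0 * μ.real Set.univ)) := by
    refine Tendsto.mono_left (ContinuousAt.tendsto ?_) nhdsWithin_le_nhds
    have : ContinuousAt (fun δ : ℝ => (1 - δ * (1 + R / r))⁻¹) 0 :=
      ContinuousAt.inv₀ (by fun_prop) (by simp)
    fun_prop
  have hM : 0 < 1 + R / r := by positivity
  have hev : ∀ᶠ δ in 𝓝[>] (0 : ℝ), ∫ v, supp L v ∂μ ≤
      (1 - δ * (1 + R / r))⁻¹ ^ m * c * ((m + 1) * volume.real L) + R * δ * μ.real Set.univ := by
    filter_upwards [Ioo_mem_nhdsGT (lt_min (div_pos hr hR) (inv_pos.2 hM))] with δ hδ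
    have h1 := hδ.2.trans_le (min_le_left _ _)
    have h2 := hδ.2.trans_le (min_le_right _ _)
    rw [lt_div_iff₀ hR] at h1
    rw [← one_div, lt_div_iff₀ hM] at h2
    exact integral_supp_le_of_mesh hc hL hLc hr hR hrL hRL hμ hδ.1 (by linarith) h2
  have := ge_of_tendsto ht hev
  simpa using this

end MixedVolumeSelf

section MixedVolumeUpper

open scoped Pointwise

theorem mem_of_forall_inner_le_supp {n : ℕ} {K : Set (En n)} (hK : Convex ℝ K) (hKc : IsCompact K)
    (hne : K.Nonempty) {z : En n} (h : ∀ v : En n, ‖v‖ = 1 → ⟪z, v⟫_ℝ ≤ supp K v) : z ∈ K := by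
  obtain ⟨y, hy, hd⟩ := exists_dist_le_of_forall_inner_le hK hKc hne (x := z) le_rfl fun v hv => by
    obtain ⟨y, hy, hyv⟩ := exists_inner_eq_supp hKc hne v
    exact ⟨y, hy, by rw [hyv, add_zero]; exact h v hv⟩
  rwa [dist_le_zero.1 hd]

theorem mem_revSph_of_inner_eq_supp {n : ℕ} {K : Set (En n)} (hK : IsCompact K) {F : Set (Sph n)}
    {v : Sph n} (hv : v ∈ F) {p : En n} (hp : p ∈ K) (hpv : ⟪p, (v : En n)⟫_ℝ = supp K v) :
    p ∈ revSph K F := by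
  have hle : ∀ y ∈ K, ⟪y - p, (v : En n)⟫_ℝ ≤ 0 := fun y hy => by
    rw [inner_sub_left, hpv]
    linarith [inner_le_supp hK hy (v : En n)]
  refine ⟨⟨subset_closure hp, fun hint => ?_⟩, v, hv, hle⟩
  have hv1 : ‖(v : En n)‖ = 1 := by simp
  obtain ⟨e, he, hb⟩ := Metric.isOpen_iff.1 isOpen_interior _ hint
  have hy : p + (e / 2) • (v : En n) ∈ K := interior_subset (hb (by
    rw [mem_ball, dist_self_add_left, norm_smul, hv1, Real.norm_of_nonneg (by positivity)]
    linarith))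
  have h1 := hle _ hy
  rw [add_sub_cancel_left, real_inner_smul_left, real_inner_self_eq_norm_sq, hv1] at h1
  linarith

theorem exists_touching {m : ℕ} {K L : Set (En (m + 1))} (hK : Convex ℝ K) (hKc : IsCompact K)
    (hKn : K.Nonempty) (hL : Convex ℝ L) (hLc : IsCompact L) {r R : ℝ} (hr : 0 < r)
    (hRK : K ⊆ closedBall 0 R) (hrL : closedBall 0 r ⊆ L) (hRL : L ⊆ closedBall 0 R) {t : ℝ}
    (ht : 0 ≤ t) {z : En (m + 1)} (hz : z ∈ K + t • L) (hzK : z ∉ K) :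
    ∃ v : Sph (m + 1), ∃ p ∈ K, ∃ l ∈ L, ∃ s ∈ Set.Icc 0 t, z = p + s • l ∧
      ⟪p, (v : En (m + 1))⟫_ℝ = supp K v ∧ ⟪l, (v : En (m + 1))⟫_ℝ = supp L v := by
  have hLn : L.Nonempty := ⟨0, hrL (by simpa using hr.le)⟩
  have hpos : ∀ v : Sph (m + 1), 0 < supp L v := fun v =>
    hr.trans_le (le_supp_of_closedBall_subset hLc hr.le hrL (by simp))
  have : Nonempty (Sph (m + 1)) :=
    (NormedSpace.sphere_nonempty (x := (0 : En (m + 1))) (r := 1)).2 zero_le_one |>.to_subtype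
  let φ : Sph (m + 1) → ℝ := fun v => (⟪z, (v : En (m + 1))⟫_ℝ - supp K v) / supp L v
  have hφ : Continuous φ := by
    have h1 := (continuous_supp hKc hKn hRK).comp (continuous_subtype_val (p := (· ∈ Sph (m + 1))))
    have h2 := (continuous_supp hLc hLn hRL).comp (continuous_subtype_val (p := (· ∈ Sph (m + 1))))
    exact (((by fun_prop : Continuous fun v : Sph (m + 1) => ⟪z, (v : En (m + 1))⟫_ℝ)).sub h1).div
      h2 fun v => (hpos v).ne'
  obtain ⟨v, -, hv⟩ := isCompact_univ.exists_isMaxOn Set.univ_nonempty hφ.continuousOn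
  have hmax : ∀ w, φ w ≤ φ v := fun w => hv (Set.mem_univ w)
  have hs0 : 0 < φ v := by
    by_contra hcon
    refine hzK (mem_of_forall_inner_le_supp hK hKc hKn fun w hw => ?_)
    have h1 := (hmax ⟨w, by simpa using hw⟩).trans (not_lt.1 hcon)
    have h2 := mul_le_mul_of_nonneg_right h1 (hpos ⟨w, by simpa using hw⟩).le
    simp only [φ] at h2
    rw [div_mul_cancel₀ _ (hpos ⟨w, by simpa using hw⟩).ne'] at h2
    linarith
  have hst : φ v ≤ t := by
    obtain ⟨a, ha, _, ⟨b, hb, rfl⟩, rfl⟩ := hz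
    rw [div_le_iff₀ (hpos v), inner_add_left, real_inner_smul_left]
    have h1 := inner_le_supp hKc ha (v : En (m + 1))
    have h2 := mul_le_mul_of_nonneg_left (inner_le_supp hLc hb (v : En (m + 1))) ht
    linarith
  set s := φ v with hs
  have hzs : z ∈ K + s • L := by
    refine mem_of_forall_inner_le_supp (hK.add (hL.smul s)) (hKc.add (hLc.smul s))
      (hKn.add (hLn.smul_set)) fun w hw => ?_
    obtain ⟨a, ha, haw⟩ := exists_inner_eq_supp hKc hKn w
    obtain ⟨b, hb, hbw⟩ := exists_inner_eq_supp hLc hLn w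
    have h1 := inner_le_supp (hKc.add (hLc.smul s)) (Set.add_mem_add ha
      (Set.smul_mem_smul_set (a := s) hb)) w
    rw [inner_add_left, real_inner_smul_left, haw, hbw] at h1
    have h2 := hmax ⟨w, by simpa using hw⟩
    rw [div_le_iff₀ (hpos _)] at h2
    simp only at h2
    linarith
  obtain ⟨p, hp, _, ⟨l, hl, rfl⟩, hpl⟩ := hzs
  simp only at hpl
  have h1 := inner_le_supp hKc hp (v : En (m + 1))
  have h2 := inner_le_supp hLc hl (v : En (m + 1))
  have h3 : ⟪p, (v : En (m + 1))⟫_ℝ + s * ⟪l, (v : En (m + 1))⟫_ℝ = supp K v + s * supp L v := by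
    have : s * supp L v = ⟪z, (v : En (m + 1))⟫_ℝ - supp K v := div_mul_cancel₀ _ (hpos v).ne'
    rw [this, ← hpl, inner_add_left, real_inner_smul_left]
    ring
  have h4 := mul_le_mul_of_nonneg_left h2 hs0.le
  refine ⟨v, p, hp, l, hl, s, ⟨hs0.le, hst⟩, hpl.symm, by linarith, ?_⟩
  have : s * ⟪l, (v : En (m + 1))⟫_ℝ = s * supp L v := by linarith
  exact mul_left_cancel₀ hs0.ne' this

theorem volume_slab_le {m : ℕ} {K L : Set (En (m + 1))} (hK : IsCompact K) (hLc : IsCompact L)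
    {R : ℝ} (hRL : L ⊆ closedBall 0 R) {F : Set (Sph (m + 1))} (hF : IsClosed F)
    {u : En (m + 1)} {δ : ℝ} (hδ0 : 0 ≤ δ) (hδ : δ ≤ 1 / 2)
    (hFu : ∀ v ∈ F, ‖(v : En (m + 1)) - u‖ ≤ δ)
    {Θ : En (m + 1) ≃L[ℝ] En m × ℝ} (hΘ : MeasurePreserving Θ volume volume)
    (h2 : ∀ z, (Θ z).2 = ⟪z, u⟫_ℝ) (hn : ∀ z, ‖z‖ ^ 2 = ‖(Θ z).1‖ ^ 2 + (Θ z).2 ^ 2) {t : ℝ}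
    (ht : 0 ≤ t) :
    volume ((fun q : En (m + 1) × En (m + 1) × ℝ => q.1 + q.2.2 • q.2.1) ''
        (revSph K F ×ˢ (L ∩ {l | 0 ≤ ⟪l, u⟫_ℝ}) ×ˢ Set.Icc 0 t)) ≤
      ENNReal.ofReal (t * (supp L u + 4 * R * δ)) *
        volume (cthickening (t * R) ((fun z => (Θ z).1) '' revSph K F)) := by
  set S := (fun q : En (m + 1) × En (m + 1) × ℝ => q.1 + q.2.2 • q.2.1) ''
        (revSph K F ×ˢ (L ∩ {l | 0 ≤ ⟪l, u⟫_ℝ}) ×ˢ Set.Icc 0 t) with hS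
  have hLu : IsCompact (L ∩ {l | 0 ≤ ⟪l, u⟫_ℝ}) :=
    hLc.inter_right (isClosed_le continuous_const (by fun_prop))
  have hSc : IsCompact S :=
    ((isCompact_revSph hK hF).prod (hLu.prod isCompact_Icc)).image (by fun_prop)
  have hSm : MeasurableSet (Θ '' S) := (hSc.image Θ.continuous).isClosed.measurableSet
  have hfst : ∀ z, ‖(Θ z).1‖ ≤ ‖z‖ := fun z =>
    (abs_le_of_sq_le_sq' (by nlinarith [hn z, sq_nonneg (Θ z).2]) (norm_nonneg _)).2
  have hle : ∀ z, ‖z‖ ≤ ‖(Θ z).1‖ + |⟪z, u⟫_ℝ| := fun z => by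
    have := hn z
    rw [h2, ← sq_abs ⟪z, u⟫_ℝ] at this
    exact (abs_le_of_sq_le_sq' (by nlinarith [norm_nonneg (Θ z).1, abs_nonneg ⟪z, u⟫_ℝ])
      (by positivity)).2
  have hsl : ∀ l ∈ L, ∀ s ∈ Set.Icc 0 t, ‖s • (Θ l).1‖ ≤ t * R := fun l hl s hs => by
    rw [norm_smul, Real.norm_of_nonneg hs.1]
    have : ‖l‖ ≤ R := by simpa using hRL hl
    exact mul_le_mul hs.2 ((hfst l).trans this) (norm_nonneg _) ht
  rw [← volume_image_of_measurePreserving hΘ, Measure.volume_eq_prod, Measure.prod_apply hSm,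
    ← lintegral_indicator_const isClosed_cthickening.measurableSet]
  refine lintegral_mono fun w => ?_
  by_cases hw : w ∈ cthickening (t * R) ((fun z => (Θ z).1) '' revSph K F)
  · rw [Set.indicator_of_mem hw]
    refine (Real.volume_le_diam _).trans (ediam_le ?_)
    rintro a ⟨_, ⟨⟨p, l, s⟩, ⟨hp, ⟨hl, hlu⟩, hs⟩, rfl⟩, hza⟩ a'
      ⟨_, ⟨⟨p', l', s'⟩, ⟨hp', ⟨hl', hlu'⟩, hs'⟩, rfl⟩, hza'⟩
    simp only [Set.mem_ofPred_eq] at hlu hlu'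
    rw [edist_dist, Real.dist_eq]
    refine ENNReal.ofReal_le_ofReal ?_
    have e1 := congrArg Prod.fst hza
    have e1' := congrArg Prod.fst hza'
    have e2 := congrArg Prod.snd hza
    have e2' := congrArg Prod.snd hza'
    simp only [map_add, map_smul, Prod.fst_add, Prod.snd_add, Prod.smul_fst, Prod.smul_snd,
      smul_eq_mul, h2] at e1 e1' e2 e2'
    have hd := hle (p - p')
    have hd' := abs_inner_sub_le_of_mem_revSph hK hFu hp hp'
    have hP : (Θ (p - p')).1 = s' • (Θ l').1 - s • (Θ l).1 := by
      rw [map_sub, Prod.fst_sub, sub_eq_sub_iff_add_eq_add, e1, add_comm, e1']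
    have hP' : ‖(Θ (p - p')).1‖ ≤ 2 * (t * R) := by
      rw [hP]
      linarith [norm_sub_le (s' • (Θ l').1) (s • (Θ l).1), hsl l hl s hs, hsl l' hl' s' hs']
    have hnn : ‖p - p'‖ ≤ 4 * (t * R) := by
      nlinarith [norm_nonneg (p - p')]
    have h5 : |⟪p - p', u⟫_ℝ| ≤ δ * (4 * (t * R)) :=
      hd'.trans (mul_le_mul_of_nonneg_left hnn hδ0)
    have h6 : s * ⟪l, u⟫_ℝ ≤ t * supp L u := mul_le_mul hs.2 (inner_le_supp hLc hl u) hlu ht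
    have h6' : s' * ⟪l', u⟫_ℝ ≤ t * supp L u := mul_le_mul hs'.2 (inner_le_supp hLc hl' u) hlu' ht
    have h7 : 0 ≤ s * ⟪l, u⟫_ℝ := mul_nonneg hs.1 hlu
    have h7' : 0 ≤ s' * ⟪l', u⟫_ℝ := mul_nonneg hs'.1 hlu'
    rw [inner_sub_left, abs_le] at h5
    rw [abs_le, ← e2, ← e2']
    constructor <;> linarith [h5.1, h5.2]
  · rw [Set.indicator_of_notMem hw]
    have : Prod.mk w ⁻¹' (Θ '' S) = ∅ := by
      refine Set.eq_empty_of_forall_notMem ?_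
      rintro a ⟨_, ⟨⟨p, l, s⟩, ⟨hp, ⟨hl, -⟩, hs⟩, rfl⟩, hza⟩
      refine hw (mem_cthickening_of_dist_le _ (Θ p).1 _ _ ⟨p, hp, rfl⟩ ?_)
      have e1 := congrArg Prod.fst hza
      simp only [map_add, map_smul, Prod.fst_add, Prod.smul_fst] at e1
      rw [← e1, dist_self_add_left]
      exact hsl l hl s hs
    rw [this, measure_empty]

theorem le_integral_supp_of_mesh {m : ℕ} {c : ℝ≥0}
    (hc : ∀ A : Set (En m), μH[(m : ℝ)] A = c * volume A) {K L : Set (En (m + 1))}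
    (hK : Convex ℝ K) (hKc : IsCompact K) (hKn : K.Nonempty)
    (hL : Convex ℝ L) (hLc : IsCompact L) {r R : ℝ} (hr : 0 < r) (hR : 0 < R)
    (hRK : K ⊆ closedBall 0 R) (hrL : closedBall 0 r ⊆ L)
    (hRL : L ⊆ closedBall 0 R) {μ : Measure (Sph (m + 1))}
    (hμ : ∀ F : Set (Sph (m + 1)), MeasurableSet F → μ F = μH[(m : ℝ)] (revSph K F)) {J : ℝ}
    (hJ : ∀ t, 0 < t → t * J ≤ volume.real (K + t • L) - volume.real K) {δ : ℝ}
    (hδ : 0 < δ) (hδr : R * δ ≤ r) (hδ2 : δ ≤ 1 / 2) :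
    c * J ≤ ∫ v, supp L v ∂μ + 5 * R * δ * μ.real Set.univ := by
  have : IsFiniteMeasure μ := isFiniteMeasure_of_revSph hKc hμ
  have : Nonempty (Sph (m + 1)) :=
    (NormedSpace.sphere_nonempty (x := (0 : En (m + 1))) (r := 1)).2 zero_le_one |>.to_subtype
  have h0L : (0 : En (m + 1)) ∈ L := hrL (by simpa using hr.le)
  have hne : L.Nonempty := ⟨0, h0L⟩
  obtain ⟨N, u, D, hD, hdisj, hcov, hcl, hu⟩ := exists_partition μ hδ
  have hu1 : ∀ i, ‖(u i : En (m + 1))‖ = 1 := fun i => by simp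
  have hFu : ∀ i, ∀ v ∈ closure (D i), ‖(v : En (m + 1)) - u i‖ ≤ δ := fun i v hv => by
    rw [← dist_eq_norm]
    exact hu i v hv
  have hh : ∀ i, r ≤ supp L (u i) := fun i => le_supp_of_closedBall_subset hLc hr.le hrL (hu1 i)
  choose Θ hΘm hΘ2 hΘ using fun i => exists_frame (u i : En (m + 1)) (hu1 i)
  set A : ℕ → Set (En (m + 1)) := fun i => revSph K (closure (D i)) with hA
  have hAc : ∀ i, IsCompact (A i) := fun i => isCompact_revSph hKc isClosed_closure
  set P : ℕ → Set (En m) := fun i => (fun z => (Θ i z).1) '' A i with hP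
  have hPc : ∀ i, IsCompact (P i) := fun i => (hAc i).image (by fun_prop)
  set S : ℝ → ℕ → Set (En (m + 1)) := fun t i =>
    (fun q : En (m + 1) × En (m + 1) × ℝ => q.1 + q.2.2 • q.2.1) ''
      (A i ×ˢ (L ∩ {l | 0 ≤ ⟪l, (u i : En (m + 1))⟫_ℝ}) ×ˢ Set.Icc 0 t) with hS
  have hcover : ∀ t, 0 < t → K + t • L ⊆ K ∪ ⋃ i ∈ Finset.range N, S t i := by
    intro t ht z hz
    by_cases hzK : z ∈ K
    · exact Or.inl hzK
    obtain ⟨v, p, hp, l, hl, s, hs, rfl, hpv, hlv⟩ :=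
      exists_touching hK hKc hKn hL hLc hr hRK hrL hRL ht.le hz hzK
    have hv : v ∈ ⋃ i ∈ Finset.range N, D i := by rw [hcov]; exact Set.mem_univ v
    obtain ⟨i, hi, hvi⟩ := Set.mem_iUnion₂.1 hv
    refine Or.inr (Set.mem_biUnion hi ⟨(p, l, s), ⟨mem_revSph_of_inner_eq_supp hKc
      (subset_closure hvi) hp hpv, ⟨hl, ?_⟩, hs⟩, rfl⟩)
    have h1 : ⟪l, (v : En (m + 1)) - u i⟫_ℝ ≤ ‖l‖ * ‖(v : En (m + 1)) - u i‖ :=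
      real_inner_le_norm _ _
    have h2 : ‖l‖ * ‖(v : En (m + 1)) - u i‖ ≤ R * δ :=
      mul_le_mul (by simpa using hRL hl) (hFu i v (subset_closure hvi)) (norm_nonneg _) hR.le
    have h3 : r ≤ supp L v := le_supp_of_closedBall_subset hLc hr.le hrL (by simp)
    rw [inner_sub_right, hlv] at h1
    simp only [Set.mem_ofPred_eq]
    linarith
  have hbd : ∀ t, 0 < t → J ≤ ∑ i ∈ Finset.range N, (supp L (u i) + 4 * R * δ) *
      volume.real (cthickening (t * R) (P i)) := by
    intro t ht
    have hfin : ∀ i, volume (cthickening (t * R) (P i)) ≠ ∞ := fun i =>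
      ((hPc i).cthickening).measure_lt_top.ne
    have h1 : volume (K + t • L) ≤ volume K + ∑ i ∈ Finset.range N,
        ENNReal.ofReal (t * (supp L (u i) + 4 * R * δ)) *
          volume (cthickening (t * R) (P i)) := by
      refine (measure_mono (hcover t ht)).trans ((measure_union_le _ _).trans ?_)
      refine add_le_add_right ((measure_biUnion_finset_le _ _).trans
        (Finset.sum_le_sum fun i _ => ?_)) _
      exact volume_slab_le hKc hLc hRL isClosed_closure hδ.le hδ2 (hFu i) (hΘm i) (hΘ2 i)
        (hΘ i) ht.le
    have hsum : ∑ i ∈ Finset.range N, ENNReal.ofReal (t * (supp L (u i) + 4 * R * δ)) *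
          volume (cthickening (t * R) (P i)) ≠ ∞ :=
      ENNReal.sum_ne_top.2 fun i _ => ENNReal.mul_ne_top ENNReal.ofReal_ne_top (hfin i)
    have h2 := ENNReal.toReal_mono (ENNReal.add_ne_top.2 ⟨hKc.measure_lt_top.ne, hsum⟩) h1
    rw [ENNReal.toReal_add hKc.measure_lt_top.ne hsum, ENNReal.toReal_sum (fun i _ =>
      ENNReal.mul_ne_top ENNReal.ofReal_ne_top (hfin i))] at h2
    have h3 : ∀ i, (ENNReal.ofReal (t * (supp L (u i) + 4 * R * δ)) *
          volume (cthickening (t * R) (P i))).toReal = t * ((supp L (u i) + 4 * R * δ) *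
          volume.real (cthickening (t * R) (P i))) := fun i => by
      have := hr.le.trans (hh i)
      rw [ENNReal.toReal_mul, ENNReal.toReal_ofReal (by positivity), mul_assoc]
      rfl
    simp only [h3, ← Finset.mul_sum] at h2
    have h4 := hJ t ht
    simp only [Measure.real] at h4 h2 ⊢
    exact le_of_mul_le_mul_left (by linarith) ht
  have hlim : J ≤ ∑ i ∈ Finset.range N, (supp L (u i) + 4 * R * δ) * volume.real (P i) := by
    have h1 : Tendsto (fun t : ℝ => t * R) (𝓝[>] 0) (𝓝 0) := by
      have : Tendsto (fun t : ℝ => t * R) (𝓝 0) (𝓝 (0 * R)) := by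
        exact (continuous_mul_const R).tendsto 0
      rw [zero_mul] at this
      exact this.mono_left nhdsWithin_le_nhds
    have ht : Tendsto (fun t : ℝ => ∑ i ∈ Finset.range N, (supp L (u i) + 4 * R * δ) *
        volume.real (cthickening (t * R) (P i))) (𝓝[>] 0)
        (𝓝 (∑ i ∈ Finset.range N, (supp L (u i) + 4 * R * δ) * volume.real (P i))) := by
      refine tendsto_finsetSum _ fun i _ => Tendsto.const_mul _ ?_
      exact (ENNReal.tendsto_toReal (hPc i).measure_lt_top.ne).comp
        ((tendsto_measure_cthickening_of_isCompact (hPc i)).comp h1)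
    exact ge_of_tendsto ht (eventually_mem_nhdsWithin.mono fun t ht => hbd t ht)
  have hPD : ∀ i, c * volume.real (P i) ≤ μ.real (D i) := fun i => by
    have h1 : c * volume (P i) ≤ μ (D i) := by
      rw [← hc, ← hcl, hμ _ isClosed_closure.measurableSet]
      refine hausdorffMeasure_image_le_of_dist_le _ (fun x y => ?_) m
      rw [dist_eq_norm, dist_eq_norm, ← Prod.fst_sub, ← map_sub]
      exact (abs_le_of_sq_le_sq' (by nlinarith [hΘ i (x - y), sq_nonneg (Θ i (x - y)).2])
        (norm_nonneg _)).2
    have h2 := ENNReal.toReal_mono (measure_ne_top _ _) h1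
    rwa [ENNReal.toReal_mul] at h2
  have hu : μ.real Set.univ = ∑ i ∈ Finset.range N, μ.real (D i) := by
    rw [← hcov]
    exact measureReal_biUnion_finset (fun i _ j _ hij => hdisj hij) fun i _ => hD i
  have hfinal : c * J ≤ ∑ i ∈ Finset.range N, supp L (u i) * μ.real (D i) +
      4 * R * δ * μ.real Set.univ := by
    calc c * J ≤ c * ∑ i ∈ Finset.range N, (supp L (u i) + 4 * R * δ) * volume.real (P i) := by
          gcongr
      _ = ∑ i ∈ Finset.range N, (supp L (u i) + 4 * R * δ) * (c * volume.real (P i)) := by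
          rw [Finset.mul_sum]
          exact Finset.sum_congr rfl fun i _ => by ring
      _ ≤ ∑ i ∈ Finset.range N, (supp L (u i) + 4 * R * δ) * μ.real (D i) := by
          gcongr with i
          · have := hr.le.trans (hh i)
            positivity
          · exact hPD i
      _ = _ := by
          rw [hu, Finset.mul_sum, ← Finset.sum_add_distrib]
          exact Finset.sum_congr rfl fun i _ => by ring
  have hint := abs_integral_sub_sum_le (integrable_supp hLc hne hRL μ) (u := u) hD hdisj hcov
    (a := R * δ) (fun i v hv => (abs_supp_sub_le hLc hne hRL _ _).trans
      (mul_le_mul_of_nonneg_left (hFu i v (subset_closure hv)) hR.le))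
  linarith [(abs_le.1 hint).1]

theorem le_integral_supp {m : ℕ} {c : ℝ≥0}
    (hc : ∀ A : Set (En m), μH[(m : ℝ)] A = c * volume A) {K L : Set (En (m + 1))}
    (hK : Convex ℝ K) (hKc : IsCompact K) (hKn : K.Nonempty)
    (hL : Convex ℝ L) (hLc : IsCompact L) {r R : ℝ} (hr : 0 < r) (hR : 0 < R)
    (hRK : K ⊆ closedBall 0 R) (hrL : closedBall 0 r ⊆ L)
    (hRL : L ⊆ closedBall 0 R) {μ : Measure (Sph (m + 1))}
    (hμ : ∀ F : Set (Sph (m + 1)), MeasurableSet F → μ F = μH[(m : ℝ)] (revSph K F)) {J : ℝ}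
    (hJ : ∀ t, 0 < t → t * J ≤ volume.real (K + t • L) - volume.real K) :
    c * J ≤ ∫ v, supp L v ∂μ := by
  have ht : Tendsto (fun δ : ℝ => ∫ v, supp L v ∂μ + 5 * R * δ * μ.real Set.univ) (𝓝[>] 0)
      (𝓝 (∫ v, supp L v ∂μ + 5 * R * 0 * μ.real Set.univ)) :=
    ((by fun_prop : Continuous (fun δ : ℝ => ∫ v, supp L v ∂μ +
      5 * R * δ * μ.real Set.univ)).tendsto 0).mono_left nhdsWithin_le_nhds
  have hev : ∀ᶠ δ in 𝓝[>] (0 : ℝ), c * J ≤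
      ∫ v, supp L v ∂μ + 5 * R * δ * μ.real Set.univ := by
    filter_upwards [Ioo_mem_nhdsGT (lt_min (div_pos hr hR) one_half_pos)] with δ hδ
    have h1 := hδ.2.trans_le (min_le_left _ _)
    rw [lt_div_iff₀ hR] at h1
    exact le_integral_supp_of_mesh hc hK hKc hKn hL hLc hr hR hRK hrL hRL hμ hJ hδ.1 (by linarith)
      (hδ.2.trans_le (min_le_right _ _)).le
  have := ge_of_tendsto ht hev
  simpa using this

end MixedVolumeUpper

section Moments

theorem integrable_of_continuous_sphere {n : ℕ} (μ : Measure (Sph n)) [IsFiniteMeasure μ]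
    {f : Sph n → ℝ} (hf : Continuous f) : Integrable f μ :=
  hf.integrable_of_hasCompactSupport (HasCompactSupport.of_compactSpace f)

theorem integral_eval_eq_of_moments {n s : ℕ} {μ ν : Measure (Sph n)} [IsFiniteMeasure μ]
    [IsFiniteMeasure ν]
    (h : ∀ i : Fin n → ℕ, (∑ j, i j) ≤ s → sphMoment μ i = sphMoment ν i)
    (P : MvPolynomial (Fin n) ℝ) (hP : P.totalDegree ≤ s) :
    ∫ u, MvPolynomial.eval (fun j => (u : En n) j) P ∂μ =
      ∫ u, MvPolynomial.eval (fun j => (u : En n) j) P ∂ν := by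
  have key : ∀ (κ : Measure (Sph n)) [IsFiniteMeasure κ],
      ∫ u, MvPolynomial.eval (fun j => (u : En n) j) P ∂κ =
        ∑ d ∈ P.support, P.coeff d * sphMoment κ d := by
    intro κ _
    simp only [MvPolynomial.eval_eq']
    rw [integral_finsetSum]
    · simp only [integral_const_mul, sphMoment]
    · intro d _
      exact (integrable_of_continuous_sphere κ (by fun_prop)).const_mul _
  rw [key μ, key ν]
  refine Finset.sum_congr rfl fun d hd => ?_
  have h1 := MvPolynomial.le_totalDegree hd
  rw [Finsupp.sum_fintype _ _ fun _ => rfl] at h1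
  rw [h d (h1.trans hP)]

/-- The Bernstein weight on `[-1, 1]`. -/
def bernWeight (N k : ℕ) (q : ℝ) : ℝ :=
  (N.choose k : ℝ) * ((1 + q) / 2) ^ k * ((1 - q) / 2) ^ (N - k)

/-- The Bernstein node in `[-1, 1]`. -/
def bernNode (N k : ℕ) : ℝ := 2 * ((k : ℝ) / N) - 1

theorem bernWeight_eq {N k : ℕ} {q : ℝ} (hq : |q| ≤ 1) :
    bernWeight N k q = bernstein N k
      ⟨(1 + q) / 2, by constructor <;> linarith [(abs_le.1 hq).1, (abs_le.1 hq).2]⟩ := by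
  rw [bernstein_apply, bernWeight]
  congr 2
  simp only
  ring

theorem bernWeight_nonneg {N k : ℕ} {q : ℝ} (hq : |q| ≤ 1) : 0 ≤ bernWeight N k q := by
  rw [bernWeight_eq hq]
  exact bernstein_nonneg

theorem sum_bernWeight {N : ℕ} {q : ℝ} (hq : |q| ≤ 1) :
    ∑ k : Fin (N + 1), bernWeight N k q = 1 := by
  simp only [bernWeight_eq hq]
  exact bernstein.probability N _

theorem sum_bernWeight_mul_sq_le {N : ℕ} {q : ℝ} (hq : |q| ≤ 1) :
    ∑ k : Fin (N + 1), bernWeight N k q * (q - bernNode N k) ^ 2 ≤ 4 / (N + 1) := by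
  obtain ⟨hq1, hq2⟩ := abs_le.1 hq
  rcases Nat.eq_zero_or_pos N with rfl | hN
  · simp [bernWeight, bernNode]
    nlinarith
  · have h := bernstein.variance hN.ne'
      ⟨(1 + q) / 2, by constructor <;> linarith⟩
    have hN' : (1 : ℝ) ≤ N := by exact_mod_cast hN
    have h2 : ∑ k : Fin (N + 1), bernWeight N k q * (q - bernNode N k) ^ 2 =
        4 * ((1 + q) / 2 * (1 - (1 + q) / 2) / N) := by
      rw [← h, Finset.mul_sum]
      refine Finset.sum_congr rfl fun k _ => ?_
      rw [bernWeight_eq hq]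
      simp only [bernstein.z, bernNode]
      ring
    rw [h2, mul_div_assoc', div_le_div_iff₀ (by linarith) (by linarith)]
    nlinarith [sq_nonneg q, mul_nonneg (sq_nonneg q) (by linarith : (0:ℝ) ≤ N)]

/-- The tensor product Bernstein polynomial. -/
def bernPoly {n : ℕ} (N : ℕ) (k : Fin n → Fin (N + 1)) : MvPolynomial (Fin n) ℝ :=
  ∏ j, (MvPolynomial.C (N.choose (k j) : ℝ) *
    (MvPolynomial.C (1 / 2) * (1 + MvPolynomial.X j)) ^ (k j : ℕ) *
    (MvPolynomial.C (1 / 2) * (1 - MvPolynomial.X j)) ^ (N - (k j : ℕ)))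

theorem eval_bernPoly {n N : ℕ} (k : Fin n → Fin (N + 1)) (q : Fin n → ℝ) :
    MvPolynomial.eval q (bernPoly N k) = ∏ j, bernWeight N (k j) (q j) := by
  rw [bernPoly, MvPolynomial.eval_prod]
  refine Finset.prod_congr rfl fun j _ => ?_
  simp only [map_mul, map_pow, map_add, map_sub, map_one, MvPolynomial.eval_C,
    MvPolynomial.eval_X, bernWeight]
  congr 2
  · ring
  · ring

theorem totalDegree_bernPoly_le {n N : ℕ} (k : Fin n → Fin (N + 1)) :
    (bernPoly N k).totalDegree ≤ n * N := by
  refine (MvPolynomial.totalDegree_finsetProd _ _).trans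
    ((Finset.sum_le_card_nsmul _ _ N fun j _ => ?_).trans (by simp))
  have hX : (MvPolynomial.X j : MvPolynomial (Fin n) ℝ).totalDegree ≤ 1 := by simp
  have h1 : (MvPolynomial.C (1 / 2) * (1 + MvPolynomial.X j) :
      MvPolynomial (Fin n) ℝ).totalDegree ≤ 1 := by
    refine (MvPolynomial.totalDegree_mul _ _).trans ?_
    rw [MvPolynomial.totalDegree_C, zero_add]
    exact (MvPolynomial.totalDegree_add _ _).trans (by simp)
  have h2 : (MvPolynomial.C (1 / 2) * (1 - MvPolynomial.X j) :
      MvPolynomial (Fin n) ℝ).totalDegree ≤ 1 := by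
    refine (MvPolynomial.totalDegree_mul _ _).trans ?_
    rw [MvPolynomial.totalDegree_C, zero_add]
    exact (MvPolynomial.totalDegree_sub _ _).trans (by simp)
  refine (MvPolynomial.totalDegree_mul _ _).trans ?_
  refine (add_le_add_left (MvPolynomial.totalDegree_mul _ _) _).trans ?_
  rw [MvPolynomial.totalDegree_C, zero_add]
  have h3 := (MvPolynomial.totalDegree_pow (MvPolynomial.C (1 / 2) * (1 + MvPolynomial.X j) :
      MvPolynomial (Fin n) ℝ) (k j : ℕ)).trans (Nat.mul_le_mul_left _ h1)
  have h4 := (MvPolynomial.totalDegree_pow (MvPolynomial.C (1 / 2) * (1 - MvPolynomial.X j) :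
      MvPolynomial (Fin n) ℝ) (N - (k j : ℕ))).trans (Nat.mul_le_mul_left _ h2)
  have := (k j).is_le
  omega

theorem sum_prod_bernWeight {n N : ℕ} {q : Fin n → ℝ} (hq : ∀ j, |q j| ≤ 1) :
    ∑ k : Fin n → Fin (N + 1), ∏ j, bernWeight N (k j) (q j) = 1 := by
  have h := Fintype.prod_sum fun (j : Fin n) (l : Fin (N + 1)) => bernWeight N l (q j)
  rw [← h]
  exact Finset.prod_eq_one fun j _ => sum_bernWeight (hq j)

theorem sum_prod_bernWeight_mul_sq_le {n N : ℕ} {q : Fin n → ℝ} (hq : ∀ j, |q j| ≤ 1)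
    (i : Fin n) :
    ∑ k : Fin n → Fin (N + 1), (∏ j, bernWeight N (k j) (q j)) * (q i - bernNode N (k i)) ^ 2 ≤
      4 / (N + 1) := by
  have h := Fintype.prod_sum fun (j : Fin n) (l : Fin (N + 1)) =>
    bernWeight N l (q j) * (if j = i then (q i - bernNode N l) ^ 2 else 1)
  have h2 : ∀ k : Fin n → Fin (N + 1),
      ∏ j, (bernWeight N (k j) (q j) * (if j = i then (q i - bernNode N (k j)) ^ 2 else 1)) =
      (∏ j, bernWeight N (k j) (q j)) * (q i - bernNode N (k i)) ^ 2 := fun k => by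
    rw [Finset.prod_mul_distrib, Finset.prod_ite_eq' Finset.univ i
      (fun j => (q i - bernNode N (k j)) ^ 2), if_pos (Finset.mem_univ _)]
  simp only [h2] at h
  rw [← h, Finset.prod_eq_single i]
  · simpa using sum_bernWeight_mul_sq_le (hq i)
  · intro j _ hj
    simpa [hj] using sum_bernWeight (hq j)
  · simp

/-- Tensor product Bernstein operator applied to a Lipschitz function. -/
theorem abs_sub_bern_le {n N : ℕ} {f : En n → ℝ} {R : ℝ} (hR : 0 ≤ R)
    (hf : ∀ u v, |f u - f v| ≤ R * ‖u - v‖) {t : ℝ} (ht : 0 < t)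
    (htN : n * (4 / (N + 1)) ≤ t ^ 2) (u : Sph n) :
    |f u - ∑ k : Fin n → Fin (N + 1), f (WithLp.toLp 2 fun j => bernNode N (k j)) *
      MvPolynomial.eval (fun j => (u : En n) j) (bernPoly N k)| ≤ R * t := by
  have hq : ∀ j, |(u : En n) j| ≤ 1 := fun j => by
    have := PiLp.norm_apply_le (u : En n) j
    have h1 : ‖(u : En n)‖ = 1 := by simp
    rwa [h1] at this
  set w : (Fin n → Fin (N + 1)) → ℝ := fun k => ∏ j, bernWeight N (k j) ((u : En n) j) with hw
  have hw0 : ∀ k, 0 ≤ w k := fun k => Finset.prod_nonneg fun j _ => bernWeight_nonneg (hq j)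
  have hw1 : ∑ k, w k = 1 := sum_prod_bernWeight hq
  set x : (Fin n → Fin (N + 1)) → En n := fun k => WithLp.toLp 2 fun j => bernNode N (k j) with hx
  have hsq : ∑ k, w k * ‖(u : En n) - x k‖ ^ 2 ≤ t ^ 2 := by
    calc ∑ k, w k * ‖(u : En n) - x k‖ ^ 2
        = ∑ i, ∑ k, w k * ((u : En n) i - bernNode N (k i)) ^ 2 := by
          rw [Finset.sum_comm]
          refine Finset.sum_congr rfl fun k _ => ?_
          rw [EuclideanSpace.real_norm_sq_eq, Finset.mul_sum]
          rfl
      _ ≤ ∑ _i : Fin n, 4 / ((N : ℝ) + 1) :=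
          Finset.sum_le_sum fun i _ => sum_prod_bernWeight_mul_sq_le hq i
      _ ≤ t ^ 2 := by simpa using htN
  simp only [eval_bernPoly]
  have e : f u - ∑ k, f (x k) * w k = ∑ k, w k * (f u - f (x k)) := by
    simp only [mul_sub, Finset.sum_sub_distrib, ← Finset.sum_mul, hw1, one_mul]
    congr 1
    exact Finset.sum_congr rfl fun k _ => mul_comm _ _
  change |f u - ∑ k, f (x k) * w k| ≤ R * t
  rw [e]
  calc |∑ k, w k * (f u - f (x k))| ≤ ∑ k, |w k * (f u - f (x k))| :=
        Finset.abs_sum_le_sum_abs _ _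
    _ ≤ ∑ k, R / 2 * (t * w k + w k * ‖(u : En n) - x k‖ ^ 2 / t) := by
        refine Finset.sum_le_sum fun k _ => ?_
        rw [abs_mul, abs_of_nonneg (hw0 k)]
        have h1 := mul_le_mul_of_nonneg_left (hf u (x k)) (hw0 k)
        have h2 : ‖(u : En n) - x k‖ ≤ (t + ‖(u : En n) - x k‖ ^ 2 / t) / 2 := by
          rw [le_div_iff₀ two_pos, ← sub_nonneg]
          have : t + ‖(u : En n) - x k‖ ^ 2 / t - ‖(u : En n) - x k‖ * 2 =
              (t - ‖(u : En n) - x k‖) ^ 2 / t := by field_simp; ring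
          rw [this]; positivity
        have h3 := mul_le_mul_of_nonneg_left h2 (mul_nonneg (hw0 k) hR)
        calc _ ≤ _ := h1
          _ = w k * R * ‖(u : En n) - x k‖ := by ring
          _ ≤ _ := h3
          _ = _ := by ring
    _ = R / 2 * (t + (∑ k, w k * ‖(u : En n) - x k‖ ^ 2) / t) := by
        rw [← Finset.mul_sum, Finset.sum_add_distrib, ← Finset.mul_sum, hw1, ← Finset.sum_div,
          mul_one]
    _ ≤ R / 2 * (t + t ^ 2 / t) := by gcongr
    _ = R * t := by field_simp; ring

/-- If the moments of two measures on the sphere agree up to order `s`, the integrals of Lipschitz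
functions differ by at most a constant multiple of `s ^ (-1/2)`. -/
theorem integral_sub_le_of_moments {n s : ℕ} (hn : 0 < n) (hs : 1 ≤ s) {μ ν : Measure (Sph n)}
    [IsFiniteMeasure μ] [IsFiniteMeasure ν]
    (h : ∀ i : Fin n → ℕ, (∑ j, i j) ≤ s → sphMoment μ i = sphMoment ν i)
    {f : En n → ℝ} (hfc : Continuous f) {R : ℝ} (hR : 0 ≤ R)
    (hf : ∀ u v, |f u - f v| ≤ R * ‖u - v‖) :
    ∫ u : Sph n, f u ∂μ ≤ ∫ u : Sph n, f u ∂ν +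
      R * (2 * n / √s) * (μ.real Set.univ + ν.real Set.univ) := by
  set N := s / n with hN
  have hs' : (0 : ℝ) < s := by exact_mod_cast hs
  have hn' : (0 : ℝ) < n := by exact_mod_cast hn
  set t : ℝ := 2 * n / √s with ht
  have ht0 : 0 < t := by positivity
  have htN : (n : ℝ) * (4 / (N + 1)) ≤ t ^ 2 := by
    rw [ht, div_pow, Real.sq_sqrt hs'.le, mul_div_assoc', div_le_div_iff₀ (by positivity) hs']
    have h1 : s ≤ n * (N + 1) := (Nat.lt_mul_div_succ s hn).le
    have h2 : (s : ℝ) ≤ n * (N + 1) := by exact_mod_cast h1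
    nlinarith
  set g : Sph n → ℝ := fun u => ∑ k : Fin n → Fin (N + 1),
    f (WithLp.toLp 2 fun j => bernNode N (k j)) *
      MvPolynomial.eval (fun j => (u : En n) j) (bernPoly N k) with hg
  have hPc : ∀ k : Fin n → Fin (N + 1), Continuous fun u : Sph n =>
      MvPolynomial.eval (fun j => (u : En n) j) (bernPoly N k) := fun k =>
    (MvPolynomial.continuous_eval _).comp (by fun_prop)
  have hgc : Continuous g := continuous_finsetSum _ fun k _ => (hPc k).const_mul _
  have hgi : ∫ u, g u ∂μ = ∫ u, g u ∂ν := by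
    simp only [hg]
    rw [integral_finsetSum _ fun k _ =>
        integrable_of_continuous_sphere μ ((hPc k).const_mul _),
      integral_finsetSum _ fun k _ => integrable_of_continuous_sphere ν ((hPc k).const_mul _)]
    refine Finset.sum_congr rfl fun k _ => ?_
    rw [integral_const_mul, integral_const_mul, integral_eval_eq_of_moments h _
      ((totalDegree_bernPoly_le k).trans (Nat.mul_div_le s n))]
  have hfg : ∀ u : Sph n, |f u - g u| ≤ R * t := abs_sub_bern_le hR hf ht0 htN
  have hfcs : Continuous fun u : Sph n => f u := hfc.comp continuous_subtype_val
  have h1 : ∫ u : Sph n, f u ∂μ ≤ ∫ u, (g u + R * t) ∂μ :=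
    integral_mono (integrable_of_continuous_sphere μ hfcs)
      (integrable_of_continuous_sphere μ (hgc.add continuous_const)) fun u => by
        have := (abs_le.1 (hfg u)).2
        simp only
        linarith
  have h2 : ∫ u, g u ∂ν ≤ ∫ u : Sph n, (f u + R * t) ∂ν :=
    integral_mono (integrable_of_continuous_sphere ν hgc)
      (integrable_of_continuous_sphere ν (hfcs.add continuous_const)) fun u => by
        have := (abs_le.1 (hfg u)).1
        simp only
        linarith
  rw [integral_add (integrable_of_continuous_sphere μ hgc) (integrable_const _), integral_const,
    smul_eq_mul] at h1
  rw [integral_add (integrable_of_continuous_sphere ν hfcs) (integrable_const _), integral_const,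
    smul_eq_mul] at h2
  rw [hgi] at h1
  linarith

end Moments

section Stability

open scoped Pointwise

theorem real_univ_le {m : ℕ} {c : ℝ≥0}
    (hc : ∀ A : Set (En m), μH[(m : ℝ)] A = c * volume A) {L : Set (En (m + 1))}
    (hL : Convex ℝ L) (hLc : IsCompact L) {r R : ℝ} (hr : 0 < r) (hR : 0 < R)
    (hrL : closedBall 0 r ⊆ L)
    (hRL : L ⊆ closedBall 0 R) {μ : Measure (Sph (m + 1))}
    (hμ : ∀ F : Set (Sph (m + 1)), MeasurableSet F → μ F = μH[(m : ℝ)] (revSph L F)) :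
    μ.real Set.univ ≤ c * ((m + 1) * volume.real (closedBall (0 : En (m + 1)) R)) / r := by
  have : IsFiniteMeasure μ := isFiniteMeasure_of_revSph hLc hμ
  have hLn : L.Nonempty := ⟨0, hrL (mem_closedBall_self hr.le)⟩
  have h1 : ∫ _v : Sph (m + 1), r ∂μ ≤ ∫ v : Sph (m + 1), supp L v ∂μ :=
    integral_mono (integrable_const _) (integrable_supp hLc hLn hRL μ) fun v =>
      le_supp_of_closedBall_subset hLc hr.le hrL (by simp)
  rw [integral_const, smul_eq_mul] at h1
  have h2 := integral_supp_le hc hL hLc hr hR hrL hRL hμ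
  have h3 : volume.real L ≤ volume.real (closedBall (0 : En (m + 1)) R) :=
    measureReal_mono hRL measure_closedBall_lt_top.ne
  rw [le_div_iff₀ hr]
  refine (h1.trans h2).trans ?_
  gcongr

theorem le_of_forall_mul_le_of_moments {m : ℕ} {K L : Set (En (m + 1))} (hK : Convex ℝ K)
    (hKc : IsCompact K) (hL : Convex ℝ L) (hLc : IsCompact L) {r R : ℝ} (hr : 0 < r) (hR : 0 < R)
    (hrK : closedBall 0 r ⊆ K) (hRK : K ⊆ closedBall 0 R) (hrL : closedBall 0 r ⊆ L)
    (hRL : L ⊆ closedBall 0 R) {μ ν : Measure (Sph (m + 1))}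
    (hμ : ∀ F : Set (Sph (m + 1)), MeasurableSet F → μ F = μH[(m : ℝ)] (revSph K F))
    (hν : ∀ F : Set (Sph (m + 1)), MeasurableSet F → ν F = μH[(m : ℝ)] (revSph L F))
    {s : ℕ} (hs : 1 ≤ s)
    (h : ∀ i : Fin (m + 1) → ℕ, (∑ j, i j) ≤ s → sphMoment μ i = sphMoment ν i) {J : ℝ}
    (hJ : ∀ t, 0 < t → t * J ≤ volume.real (K + t • L) - volume.real K) :
    J ≤ (m + 1) * volume.real L +
      4 * (m + 1) ^ 2 * R * volume.real (closedBall (0 : En (m + 1)) R) / r / √s := by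
  obtain ⟨c, hc0, hc⟩ := exists_hausdorffMeasure_eq m
  have : IsFiniteMeasure μ := isFiniteMeasure_of_revSph hKc hμ
  have : IsFiniteMeasure ν := isFiniteMeasure_of_revSph hLc hν
  have hKn : K.Nonempty := ⟨0, hrK (mem_closedBall_self hr.le)⟩
  have hLn : L.Nonempty := ⟨0, hrL (mem_closedBall_self hr.le)⟩
  have h1 := le_integral_supp hc hK hKc hKn hL hLc hr hR hRK hrL hRL hμ hJ
  have h2 := integral_sub_le_of_moments (Nat.succ_pos m) hs h (continuous_supp hLc hLn hRL) hR.le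
    (abs_supp_sub_le hLc hLn hRL)
  have h3 := integral_supp_le hc hL hLc hr hR hrL hRL hν
  have h4 := real_univ_le hc hK hKc hr hR hrK hRK hμ
  have h5 := real_univ_le hc hL hLc hr hR hrL hRL hν
  have hc0' : (0 : ℝ) < c := by exact_mod_cast hc0
  have hs' : (0 : ℝ) < s := by exact_mod_cast hs
  set V := volume.real (closedBall (0 : En (m + 1)) R)
  have h6 : R * (2 * (m + 1 : ℕ) / √s) * (μ.real Set.univ + ν.real Set.univ) ≤
      R * (2 * (m + 1 : ℕ) / √s) * (c * ((m + 1) * V) / r + c * ((m + 1) * V) / r) := by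
    gcongr
  have h7 : R * (2 * (m + 1 : ℕ) / √s) * (c * ((m + 1) * V) / r + c * ((m + 1) * V) / r) =
      c * (4 * (m + 1) ^ 2 * R * V / r / √s) := by
    push_cast
    field_simp
    ring
  refine le_of_mul_le_mul_left ?_ hc0'
  rw [mul_add, ← h7]
  linarith

theorem exists_forall_abs_supp_sub_le {m : ℕ} (hm : 1 ≤ m) {r R : ℝ} (hr : 0 < r) (hR : 0 < R) :
    ∃ C : ℝ, 0 < C ∧ ∀ K L : Set (En (m + 1)), Convex ℝ K → IsCompact K → Convex ℝ L →
      IsCompact L → closedBall 0 r ⊆ K → K ⊆ closedBall 0 R → closedBall 0 r ⊆ L →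
      L ⊆ closedBall 0 R → ∀ μ ν : Measure (Sph (m + 1)),
      (∀ F : Set (Sph (m + 1)), MeasurableSet F → μ F = μH[(m : ℝ)] (revSph K F)) →
      (∀ F : Set (Sph (m + 1)), MeasurableSet F → ν F = μH[(m : ℝ)] (revSph L F)) →
      ∀ s₀ : ℕ, 1 ≤ s₀ →
      (∀ i : Fin (m + 1) → ℕ, (∑ j, i j) ≤ s₀ → sphMoment μ i = sphMoment ν i) →
      ∃ b : En (m + 1), ∀ u : En (m + 1), ‖u‖ = 1 →
        |supp L u + ⟪b, u⟫_ℝ - supp K u| ≤ C * (s₀ : ℝ) ^ (-(1 / (4 * ((m : ℝ) + 1)))) := by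
  set V₁ := volume.real (closedBall (0 : En (m + 1)) R) with hV₁
  set v₀ := volume.real (closedBall (0 : En (m + 1)) r) with hv₀
  set w₀ := volume.real (closedBall (0 : En m) r) with hw₀
  have hpos : ∀ (k : ℕ) {ρ : ℝ}, 0 < ρ → 0 < volume.real (closedBall (0 : En k) ρ) :=
    fun k ρ hρ => ENNReal.toReal_pos (measure_closedBall_pos _ _ hρ).ne'
      measure_closedBall_lt_top.ne
  have hV₁p : 0 < V₁ := hpos _ hR
  have hv₀p : 0 < v₀ := hpos _ hr
  have hw₀p : 0 < w₀ := hpos _ hr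
  set A := √(4 * (m + 1) ^ 2 * R * V₁ / r) with hA
  have hAp : 0 < A := Real.sqrt_pos.2 (by positivity)
  have hA2 : A ^ 2 = 4 * (m + 1) ^ 2 * R * V₁ / r := Real.sq_sqrt (by positivity)
  set Q := 2 * V₁ * (1 / v₀ + 1 + A ^ 2 / v₀) + A + V₁ * (2 * A / v₀) with hQ
  have hQp : 0 < Q := by positivity
  refine ⟨r + Q * A / ((r / 2 / R) ^ m * w₀), by positivity, ?_⟩
  intro K L hK hKc hL hLc hrK hRK hrL hRL μ ν hμ hν s₀ hs h
  have hs' : (1 : ℝ) ≤ s₀ := by exact_mod_cast hs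
  have hs0 : (0 : ℝ) < s₀ := by linarith
  set x := (s₀ : ℝ) ^ (-(1 / (4 * ((m : ℝ) + 1)))) with hx
  have hxp : 0 < x := Real.rpow_pos_of_pos hs0 _
  have hx1 : x ≤ 1 := Real.rpow_le_one_of_one_le_of_nonpos hs' (by
    rw [neg_nonpos]; positivity)
  have hxs : (x ^ (m + 1)) ^ 2 = 1 / √s₀ := by
    rw [← pow_mul, hx, ← Real.rpow_natCast, ← Real.rpow_mul hs0.le, Real.sqrt_eq_rpow,
      one_div ((s₀ : ℝ) ^ _), ← Real.rpow_neg hs0.le]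
    congr 1
    push_cast
    field_simp
    norm_num
  have hs2 : (A * x ^ (m + 1)) ^ 2 = 4 * (m + 1) ^ 2 * R * V₁ / r / √s₀ := by
    rw [mul_pow, hA2, hxs]
    ring
  have hsA : A * x ^ (m + 1) ≤ A := mul_le_of_le_one_right hAp.le (pow_le_one₀ hxp.le hx1)
  have hKL : ∀ J : ℝ, (∀ t : ℝ, 0 < t → t * J ≤ volume.real (K + t • L) - volume.real K) →
      J ≤ (m + 1) * volume.real L + (A * x ^ (m + 1)) ^ 2 := fun J hJ => by
    rw [hs2]
    exact le_of_forall_mul_le_of_moments hK hKc hL hLc hr hR hrK hRK hrL hRL hμ hν hs h hJ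
  have hLK : ∀ J : ℝ, (∀ t : ℝ, 0 < t → t * J ≤ volume.real (L + t • K) - volume.real L) →
      J ≤ (m + 1) * volume.real K + (A * x ^ (m + 1)) ^ 2 := fun J hJ => by
    rw [hs2]
    exact le_of_forall_mul_le_of_moments hL hLc hK hKc hr hR hrL hRL hrK hRK hν hμ hs
      (fun i hi => (h i hi).symm) hJ
  have hd : 0 < r / 2 * x := by positivity
  have hdr : r / 2 * x < r := by nlinarith
  have hE : 2 * (r / 2 * x) + Q * (A * x ^ (m + 1)) / ((r / 2 * x / R) ^ m * w₀) =
      (r + Q * A / ((r / 2 / R) ^ m * w₀)) * x := by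
    have : (r / 2 * x / R) ^ m = (r / 2 / R) ^ m * x ^ m := by rw [← mul_pow]; ring
    rw [this, pow_succ]
    field_simp
  refine ⟨bary K - bary L, fun u hu => ?_⟩
  have h1 := inner_bary_le hm hK hKc hL hLc hr hrK hRK hrL hRL (by positivity) hsA hKL hLK hd hdr hu
  have h2 := inner_bary_le hm hL hLc hK hKc hr hrL hRL hrK hRK (by positivity) hsA hLK hKL hd hdr hu
  rw [← hV₁, ← hv₀, ← hw₀, ← hQ, add_assoc, hE] at h1 h2
  rw [inner_sub_left, abs_le]
  constructor <;> linarith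

theorem supp_image_add {n : ℕ} {K : Set (En n)} (hKc : IsCompact K) (hne : K.Nonempty)
    (a u : En n) : supp ((fun y => y + a) '' K) u = supp K u + ⟪a, u⟫_ℝ := by
  apply le_antisymm
  · refine csSup_le ((hne.image _).image _) ?_
    rintro _ ⟨_, ⟨y, hy, rfl⟩, rfl⟩
    simp only [inner_add_left]
    linarith [inner_le_supp hKc hy u]
  · obtain ⟨y, hy, hyu⟩ := exists_inner_eq_supp hKc hne u
    rw [← hyu, ← inner_add_left]
    exact inner_le_supp (hKc.image (continuous_add_const a)) ⟨y, hy, rfl⟩ u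

theorem revSph_image_add {n : ℕ} (K : Set (En n)) (a : En n) (F : Set (Sph n)) :
    revSph ((fun y => y + a) '' K) F = (fun y => y + a) '' revSph K F := by
  have hfr : frontier ((fun y => y + a) '' K) = (fun y => y + a) '' frontier K :=
    ((Homeomorph.addRight a).image_frontier K).symm
  ext x
  constructor
  · rintro ⟨hx, u, hu, h⟩
    rw [hfr] at hx
    obtain ⟨y, hy, rfl⟩ := hx
    refine ⟨y, ⟨hy, u, hu, fun z hz => ?_⟩, rfl⟩
    simpa using h _ ⟨z, hz, rfl⟩
  · rintro ⟨y, ⟨hy, u, hu, h⟩, rfl⟩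
    refine ⟨hfr ▸ ⟨y, hy, rfl⟩, u, hu, ?_⟩
    rintro _ ⟨z, hz, rfl⟩
    simpa using h z hz

theorem IsSurfaceAreaMeasure.eq_revSph_image_add {m : ℕ} {K : Set (En (m + 1))}
    {μ : Measure (Sph (m + 1))} (h : IsSurfaceAreaMeasure K μ) (hK : (interior K).Nonempty)
    (a : En (m + 1)) {F : Set (Sph (m + 1))} (hF : MeasurableSet F) :
    μ F = μH[(m : ℝ)] (revSph ((fun y => y + a) '' K) F) := by
  rcases h with ⟨-, h⟩ | ⟨h, -⟩
  · have hm : (((m + 1 : ℕ) : ℝ) - 1) = m := by push_cast; ring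
    have := h F hF
    rw [hm] at this
    rw [this, revSph_image_add]
    exact ((IsometryEquiv.addRight a).hausdorffMeasure_image _ _).symm
  · exact absurd h hK.ne_empty

theorem closedBall_subset_image_add {n : ℕ} {K : Set (En n)} {x : En n} {r R : ℝ}
    (h1 : closedBall x r ⊆ K) (h2 : K ⊆ closedBall x R) :
    closedBall 0 r ⊆ (fun y => y + -x) '' K ∧ (fun y => y + -x) '' K ⊆ closedBall 0 R := by
  constructor
  · intro y hy
    refine ⟨y + x, h1 ?_, by simp⟩
    simpa [mem_closedBall, dist_eq_norm] using hy
  · rintro _ ⟨y, hy, rfl⟩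
    have := h2 hy
    simpa [mem_closedBall, dist_eq_norm, sub_eq_add_neg] using this

end Stability

/-- there is a constant `c = c(n,r,R,ε) > 0` such that for convex
bodies `K, L` each containing a ball of radius `r` and contained in a
concentric ball of radius `R` (`0 < r < R`), whose surface tensors (moments of
the surface area measures) coincide up to rank `s₀`, the translative Hausdorff
distance satisfies `δᵗ(K,L) ≤ c s₀^{-(1-ε)/(4n)}`. -/
theorem stmt13 {n : ℕ} (hn : 2 ≤ n) (r R : ℝ) (hr : 0 < r) (hrR : r < R)
    (ε : ℝ) (hε0 : 0 < ε) (hε1 : ε < 1) :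
    ∃ c : ℝ, 0 < c ∧
      ∀ K L : Set (En n),
        Convex ℝ K → IsCompact K →
        Convex ℝ L → IsCompact L →
        (∃ x : En n, Metric.closedBall x r ⊆ K ∧ K ⊆ Metric.closedBall x R) →
        (∃ x : En n, Metric.closedBall x r ⊆ L ∧ L ⊆ Metric.closedBall x R) →
      ∀ μK μL : Measure (Sph n),
        IsSurfaceAreaMeasure K μK → IsSurfaceAreaMeasure L μL →
      ∀ s₀ : ℕ, 1 ≤ s₀ →
        (∀ i : Fin n → ℕ, (∑ j, i j) ≤ s₀ → sphMoment μK i = sphMoment μL i) →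
        transHausdorffDist K L ≤ c * (s₀ : ℝ) ^ (-(1 - ε) / (4 * (n : ℝ))) := by
  obtain ⟨m, rfl⟩ : ∃ m, n = m + 1 := ⟨n - 1, by omega⟩
  have hR : 0 < R := hr.trans hrR
  obtain ⟨C, hC, hmain⟩ := exists_forall_abs_supp_sub_le (m := m) (by omega) hr hR
  refine ⟨C, hC, ?_⟩
  rintro K L hK hKc hL hLc ⟨x, hxK, hKx⟩ ⟨y, hyL, hLy⟩ μK μL hμ hν s₀ hs h
  have hint : ∀ {M : Set (En (m + 1))} {z : En (m + 1)}, closedBall z r ⊆ M →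
      (interior M).Nonempty := fun {M z} hM =>
    ⟨z, interior_mono hM (ball_subset_interior_closedBall (mem_ball_self hr))⟩
  have hKn : K.Nonempty := ⟨x, hxK (mem_closedBall_self hr.le)⟩
  have hLn : L.Nonempty := ⟨y, hyL (mem_closedBall_self hr.le)⟩
  have hconv : ∀ {M : Set (En (m + 1))} (a : En (m + 1)), Convex ℝ M →
      Convex ℝ ((fun y => y + a) '' M) := fun a hM => by
    simpa only [add_comm a] using hM.translate a
  obtain ⟨hK1, hK2⟩ := closedBall_subset_image_add hxK hKx
  obtain ⟨hL1, hL2⟩ := closedBall_subset_image_add hyL hLy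
  obtain ⟨b, hb⟩ := hmain _ _ (hconv (-x) hK) (hKc.image (by fun_prop)) (hconv (-y) hL)
    (hLc.image (by fun_prop)) hK1 hK2 hL1 hL2 μK μL
    (fun F hF => hμ.eq_revSph_image_add (hint hxK) _ hF)
    (fun F hF => hν.eq_revSph_image_add (hint hyL) _ hF) s₀ hs h
  have hs' : (1 : ℝ) ≤ s₀ := by exact_mod_cast hs
  have hexp : (s₀ : ℝ) ^ (-(1 / (4 * ((m : ℝ) + 1)))) ≤
      (s₀ : ℝ) ^ (-(1 - ε) / (4 * ((m + 1 : ℕ) : ℝ))) := by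
    refine Real.rpow_le_rpow_of_exponent_le hs' ?_
    push_cast
    rw [← neg_div]
    gcongr
    linarith
  refine (transHausdorffDist_le hK hKc hKn hL hLc hLn (b := b + x - y) (by positivity)
    fun u hu => ?_).trans (mul_le_mul_of_nonneg_left hexp hC.le)
  have h1 := hb u hu
  rw [supp_image_add hKc hKn, supp_image_add hLc hLn, inner_neg_left, inner_neg_left] at h1
  rw [inner_sub_left, inner_add_left]
  convert h1 using 2
  ring
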